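/- arXiv:1601.00823 — 7 statements merged into one kernel-verified Lean document; each statement's English description precedes it below -/
import Mathlib

section
/- Let p be a monic irreducible polynomial of degree n over a field K, let k ≥ 1, and let h ∈ K[s]^q and g ∈ K[s]^t be polynomial vectors with p-adic expansions h = Σ_{i≥0} h_i p^i and g = Σ_{i≥0} g_i p^i where deg h_i < n and deg g_i < n for all i. Define matrices H_i ∈ K^{q×n} by h_i(s) = H_i b(s) and G_i ∈ K^{t×n} by g_i(s) = G_i M b(s), and set H = (H_0, …, H_{k−1}) ∈ K^{q×nk} and G = (G_{k−1}ᵀ; …; G_0ᵀ) ∈ K^{nk×t} (blocks stacked vertically). Then π₋( h · p^{−k} · gᵀ ) = H (sI − J(p^k))^{−1} G, i.e. the triple (J(p^k), G, H) is a realization of π₋(h p^{−k} gᵀ). -/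
open Polynomial Matrix Kronecker

set_option synthInstance.maxHeartbeats 1000000
set_option maxHeartbeats 1000000

noncomputable section

variable {K : Type*} [Field K]

/-- The strictly proper part of a rational function. -/
def piMinus (f : RatFunc K) : RatFunc K :=
  f - algebraMap (Polynomial K) (RatFunc K) (f.num /ₘ f.denom)

/-- A rational function is strictly proper. -/
def IsStrictlyProper (f : RatFunc K) : Prop :=
  f.num.degree < f.denom.degree

/-- Companion matrix of a polynomial, for size `n`. -/
def companion (n : ℕ) (p : Polynomial K) : Matrix (Fin n) (Fin n) K :=
  Matrix.of fun i j =>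
    if (i : ℕ) + 1 = (j : ℕ) then 1
    else if (i : ℕ) = n - 1 then -(p.coeff (j : ℕ)) else 0

/-- The Hankel matrix `M(p)`. -/
def hankelM (n : ℕ) (p : Polynomial K) : Matrix (Fin n) (Fin n) K :=
  Matrix.of fun i j =>
    if (i : ℕ) + (j : ℕ) + 1 ≤ n then p.coeff ((i : ℕ) + (j : ℕ) + 1) else 0

/-- The matrix `N_k` with ones on the superdiagonal. -/
def supN (R : Type*) [Semiring R] (k : ℕ) : Matrix (Fin k) (Fin k) R :=
  Matrix.of fun i j => if (i : ℕ) + 1 = (j : ℕ) then 1 else 0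

/-- `V = eₙ e₁ᵀ`. -/
def eV (K : Type*) [Field K] (n : ℕ) : Matrix (Fin n) (Fin n) K :=
  Matrix.of fun i j => if (i : ℕ) = n - 1 ∧ (j : ℕ) = 0 then 1 else 0

/-- Jacobson block `J(p^k)`, as an `nk × nk` matrix indexed by `Fin k × Fin n`. -/
def jacobson (n : ℕ) (p : Polynomial K) (k : ℕ) :
    Matrix (Fin k × Fin n) (Fin k × Fin n) K :=
  (1 : Matrix (Fin k) (Fin k) K) ⊗ₖ companion n p + supN K k ⊗ₖ eV K n

/-- `sI - F` as a matrix over `K(s)`. -/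
def sISub {ι : Type*} [Fintype ι] [DecidableEq ι] (F : Matrix ι ι K) :
    Matrix ι ι (RatFunc K) :=
  Matrix.diagonal (fun _ => (RatFunc.X : RatFunc K)) - F.map (algebraMap K (RatFunc K))

/-- `b(s) = (1, s, …, s^{n-1})ᵀ` as a vector over `K(s)`. -/
def bVec (K : Type*) [Field K] (n : ℕ) : Fin n → RatFunc K :=
  fun i => (RatFunc.X : RatFunc K) ^ (i : ℕ)

/-- The rank-one matrix `b(s) b(s)ᵀ`. -/
def bbT (K : Type*) [Field K] (n : ℕ) : Matrix (Fin n) (Fin n) (RatFunc K) :=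
  Matrix.of fun i j => bVec K n i * bVec K n j

section StrictlyProper

open WithZero

variable [DecidableEq (RatFunc K)]

lemma inftyValuation_algebraMap_le_one (c : K) :
    RatFunc.inftyValuation K (algebraMap K (RatFunc K) c) ≤ 1 := by
  rw [RatFunc.algebraMap_eq_C]
  rcases eq_or_ne c 0 with rfl | hc
  · simp
  · exact (RatFunc.inftyValuation.C K hc).le

lemma eq_zero_of_inftyValuation_lt_one {y : Polynomial K}
    (hy : RatFunc.inftyValuation K (algebraMap (Polynomial K) (RatFunc K) y) < 1) : y = 0 := by
  by_contra h0
  rw [RatFunc.inftyValuation_apply, RatFunc.inftyValuation.polynomial K h0, ← exp_zero,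
    exp_lt_exp] at hy
  omega

lemma inftyValuation_piMinus_lt_one (f : RatFunc K) :
    RatFunc.inftyValuation K (piMinus f) < 1 := by
  have hd : algebraMap (Polynomial K) (RatFunc K) f.denom ≠ 0 :=
    RatFunc.algebraMap_ne_zero f.denom_ne_zero
  have hf : piMinus f = algebraMap (Polynomial K) (RatFunc K) (f.num %ₘ f.denom) /
      algebraMap (Polynomial K) (RatFunc K) f.denom := by
    rw [piMinus, eq_div_iff hd, sub_mul, eq_sub_of_add_eq (modByMonic_add_div f.num f.denom),
      map_sub, map_mul, mul_comm (algebraMap _ _ (f.num /ₘ f.denom)), sub_left_inj]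
    exact (div_eq_iff hd).mp (RatFunc.num_div_denom f) |>.symm
  rw [hf]
  rcases eq_or_ne (f.num %ₘ f.denom) 0 with h0 | h0
  · simp [h0]
  · have hlt := natDegree_lt_natDegree h0 (degree_modByMonic_lt f.num f.monic_denom)
    rw [map_div₀, RatFunc.inftyValuation_apply, RatFunc.inftyValuation_apply,
      RatFunc.inftyValuation.polynomial K h0,
      RatFunc.inftyValuation.polynomial K f.denom_ne_zero, ← exp_sub, ← exp_zero, exp_lt_exp]
    omega

/-- The strictly proper part is characterised by being strictly proper and differing from the
function by a polynomial. -/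
lemma piMinus_eq_of_sub_mem_range {f w : RatFunc K} (hw : RatFunc.inftyValuation K w < 1)
    (hfw : f - w ∈ (algebraMap (Polynomial K) (RatFunc K)).range) : piMinus f = w := by
  obtain ⟨y, hy⟩ := hfw
  have hsub : piMinus f - w =
      algebraMap (Polynomial K) (RatFunc K) (y - f.num /ₘ f.denom) := by
    rw [map_sub, hy, piMinus]; ring
  have hlt := (RatFunc.inftyValuation K).map_sub_lt (inftyValuation_piMinus_lt_one f) hw
  rw [hsub] at hlt
  rw [← sub_eq_zero, hsub, eq_zero_of_inftyValuation_lt_one hlt, map_zero]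

/-- The entries of a right inverse of `sI - F` are strictly proper. -/
lemma inftyValuation_lt_one_of_sISub_mul_eq_one {ι : Type*} [Fintype ι] [DecidableEq ι]
    {F : Matrix ι ι K} {Z : Matrix ι ι (RatFunc K)} (hZ : sISub F * Z = 1) (i j : ι) :
    RatFunc.inftyValuation K (Z i j) < 1 := by
  set v := RatFunc.inftyValuation K
  have : Nonempty ι := ⟨i⟩
  obtain ⟨m, hm⟩ := Finite.exists_max fun l => v (Z l j)
  refine (hm i).trans_lt ?_
  by_contra! h1
  have hrow : RatFunc.X * Z m j =
      (1 : Matrix ι ι (RatFunc K)) m j + ∑ l, algebraMap K (RatFunc K) (F m l) * Z l j := by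
    rw [← hZ, sISub, sub_mul, Matrix.sub_apply, Matrix.diagonal_mul, Matrix.mul_apply]
    simp
  have hle : v (RatFunc.X * Z m j) ≤ v (Z m j) := by
    rw [hrow]
    refine v.map_add_le ?_ (v.map_sum_le fun l _ => ?_)
    · refine le_trans ?_ h1
      rw [Matrix.one_apply]
      split_ifs <;> simp
    · rw [map_mul]
      exact (mul_le_of_le_one_left' (inftyValuation_algebraMap_le_one _)).trans (hm l)
  have hX : 1 < v RatFunc.X := by
    rw [RatFunc.inftyValuation.X, ← exp_zero, exp_lt_exp]; exact one_pos
  rw [map_mul] at hle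
  exact (lt_mul_of_one_lt_left (zero_lt_one.trans_le h1) hX).not_ge hle

end StrictlyProper

/-- The entries of the strictly lower triangular Toeplitz matrix with powers of `s`. -/
def lowerToeplitz (K : Type*) [Field K] (u v : ℕ) : RatFunc K :=
  if v < u then RatFunc.X ^ (u - v - 1) else 0

/-- The entries of `M(p) b(s)`. -/
def hankelVec (n : ℕ) (p : Polynomial K) (v : ℕ) : RatFunc K :=
  ∑ w ∈ Finset.range (n - v), algebraMap K (RatFunc K) (p.coeff (v + 1 + w)) * RatFunc.X ^ w

/-- The scalar factor `p^{-(j-i+1)}` of the block `(i, j)`, zero below the diagonal. -/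
def blockCoeff (p : Polynomial K) (i j : ℕ) : RatFunc K :=
  if i ≤ j then ((algebraMap (Polynomial K) (RatFunc K) p) ^ (j - i + 1))⁻¹ else 0

/-- The inverse of `sI - J(p^k)`. -/
def jacobsonInv (n : ℕ) (p : Polynomial K) (k : ℕ) :
    Matrix (Fin k × Fin n) (Fin k × Fin n) (RatFunc K) :=
  Matrix.of fun iu jv =>
    blockCoeff p iu.1 jv.1 * (RatFunc.X ^ (iu.2 : ℕ) * hankelVec n p jv.2) -
      if iu.1 = jv.1 then lowerToeplitz K iu.2 jv.2 else 0

lemma lowerToeplitz_succ (u v : ℕ) :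
    lowerToeplitz K (u + 1) v = RatFunc.X * lowerToeplitz K u v + if u = v then 1 else 0 := by
  unfold lowerToeplitz
  rcases lt_trichotomy u v with h | rfl | h
  · simp [h.ne, h.not_gt, show ¬ v < u + 1 by omega]
  · simp
  · rw [if_pos (by omega), if_pos h, if_neg h.ne', add_zero, ← pow_succ',
      show u + 1 - v - 1 = u - v - 1 + 1 by omega]

lemma lowerToeplitz_mem_range (u v : ℕ) :
    lowerToeplitz K u v ∈ (algebraMap (Polynomial K) (RatFunc K)).range := by
  unfold lowerToeplitz
  split_ifs
  · exact ⟨Polynomial.X ^ (u - v - 1), by simp⟩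
  · exact zero_mem _

lemma hankelVec_eq_sum_lowerToeplitz {n v : ℕ} (p : Polynomial K) (hv : v < n) :
    hankelVec n p v = ∑ l ∈ Finset.range (n + 1),
      algebraMap K (RatFunc K) (p.coeff l) * lowerToeplitz K l v := by
  rw [show n + 1 = (v + 1) + (n - v) by omega, Finset.sum_range_add, Finset.sum_eq_zero,
    zero_add, hankelVec]
  · refine Finset.sum_congr rfl fun w _ => ?_
    rw [lowerToeplitz, if_pos (by omega), show v + 1 + w - v - 1 = w by omega]
  · intro l hl
    rw [Finset.mem_range] at hl
    rw [lowerToeplitz, if_neg (by omega), mul_zero]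

lemma sum_hankelM_eq_hankelVec (n : ℕ) (p : Polynomial K) (v : Fin n) :
    ∑ w : Fin n, algebraMap K (RatFunc K) (hankelM n p v w) * RatFunc.X ^ (w : ℕ) =
      hankelVec n p v := by
  have hsub : Finset.range (n - v) ⊆ Finset.range n := by
    intro w; simp only [Finset.mem_range]; omega
  rw [hankelVec, Finset.sum_subset_zero_on_sdiff hsub
    (g := fun w : ℕ => algebraMap K (RatFunc K)
      (if (v : ℕ) + w + 1 ≤ n then p.coeff (v + w + 1) else 0) * RatFunc.X ^ w),
    Finset.sum_range]
  · rfl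
  · intro w hw
    simp only [Finset.mem_sdiff, Finset.mem_range] at hw
    rw [if_neg (by omega), map_zero, zero_mul]
  · intro w hw
    rw [Finset.mem_range] at hw
    rw [if_pos (by omega), show (v : ℕ) + 1 + w = v + w + 1 by omega]

lemma sum_companion_mul (n : ℕ) (p : Polynomial K) (u : Fin n) (f : ℕ → RatFunc K) :
    ∑ l : Fin n, algebraMap K (RatFunc K) (companion n p u l) * f l =
      if (u : ℕ) = n - 1 then
        -∑ l ∈ Finset.range n, algebraMap K (RatFunc K) (p.coeff l) * f l
      else f (u + 1) := by
  have hu := u.isLt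
  split_ifs with h
  · rw [Finset.sum_range, ← Finset.sum_neg_distrib]
    refine Finset.sum_congr rfl fun l _ => ?_
    have hl := l.isLt
    rw [companion, Matrix.of_apply, if_neg (by omega), if_pos h, map_neg, neg_mul]
  · rw [Finset.sum_eq_single (⟨u + 1, by omega⟩ : Fin n)]
    · simp [companion]
    · intro l _ hl
      rw [companion, Matrix.of_apply, if_neg (fun h' => hl (Fin.ext h'.symm)), if_neg h,
        map_zero, zero_mul]
    · simp

lemma algebraMap_eq_sum_of_monic {n : ℕ} {p : Polynomial K} (hp : p.Monic)
    (hdeg : p.natDegree = n) :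
    algebraMap (Polynomial K) (RatFunc K) p =
      ∑ l ∈ Finset.range n, algebraMap K (RatFunc K) (p.coeff l) * RatFunc.X ^ l +
        RatFunc.X ^ n := by
  have hn : p.coeff n = 1 := hdeg ▸ hp
  conv_lhs => rw [p.as_sum_range_C_mul_X_pow, hdeg, Finset.sum_range_succ, hn]
  simp [RatFunc.algebraMap_eq_C]

/-- `(sI - C) b = p eₙ`. -/
lemma X_mul_pow_sub_sum_companion {n : ℕ} {p : Polynomial K} (hp : p.Monic)
    (hdeg : p.natDegree = n) (u : Fin n) :
    RatFunc.X * RatFunc.X ^ (u : ℕ) -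
        ∑ l : Fin n, algebraMap K (RatFunc K) (companion n p u l) * RatFunc.X ^ (l : ℕ) =
      if (u : ℕ) = n - 1 then algebraMap (Polynomial K) (RatFunc K) p else 0 := by
  have hu := u.isLt
  rw [sum_companion_mul n p u fun l => RatFunc.X ^ l, ← pow_succ']
  split_ifs with h
  · rw [algebraMap_eq_sum_of_monic hp hdeg, show (u : ℕ) + 1 = n by omega]
    ring
  · exact sub_self _

/-- `(sI - C) L = eₙ (M b)ᵀ - I` for the strictly lower triangular Toeplitz matrix `L`. -/
lemma X_mul_lowerToeplitz_sub_sum_companion {n : ℕ} {p : Polynomial K} (hp : p.Monic)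
    (hdeg : p.natDegree = n) (u v : Fin n) :
    RatFunc.X * lowerToeplitz K u v -
        ∑ l : Fin n, algebraMap K (RatFunc K) (companion n p u l) * lowerToeplitz K l v =
      (if (u : ℕ) = n - 1 then hankelVec n p v else 0) - if u = v then 1 else 0 := by
  have hu := u.isLt
  have hn : p.coeff n = 1 := hdeg ▸ hp
  have hs := lowerToeplitz_succ (K := K) u v
  simp only [← Fin.ext_iff] at hs
  rw [sum_companion_mul n p u fun l => lowerToeplitz K l v, eq_sub_of_add_eq hs.symm]
  by_cases h : (u : ℕ) = n - 1
  · rw [if_pos h, if_pos h, hankelVec_eq_sum_lowerToeplitz p v.isLt, Finset.sum_range_succ, hn,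
      show (u : ℕ) + 1 = n by omega, map_one]
    ring
  · rw [if_neg h, if_neg h]
    ring

lemma blockCoeff_mul {p : Polynomial K} (hp : p ≠ 0) {i j k : ℕ} (hj : j < k) :
    blockCoeff p i j * algebraMap (Polynomial K) (RatFunc K) p =
      (if i = j then 1 else 0) + if i + 1 < k then blockCoeff p (i + 1) j else 0 := by
  have hP : algebraMap (Polynomial K) (RatFunc K) p ≠ 0 := RatFunc.algebraMap_ne_zero hp
  unfold blockCoeff
  rcases lt_trichotomy i j with h | rfl | h
  · rw [if_pos h.le, if_neg h.ne, if_pos (by omega), if_pos (by omega),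
      show j - i + 1 = j - (i + 1) + 1 + 1 by omega, pow_succ _ (j - (i + 1) + 1)]
    field_simp
    ring
  · simp [hP]
  · rw [if_neg h.not_ge, if_neg h.ne', if_neg (show ¬ i + 1 ≤ j by omega)]
    simp

lemma sum_supN_eV_mul {n k : ℕ} (hn : 1 ≤ n) (i : Fin k) (u : Fin n)
    (f : ℕ → ℕ → RatFunc K) :
    ∑ j : Fin k, ∑ l : Fin n,
        algebraMap K (RatFunc K) (supN K k i j * eV K n u l) * f j l =
      if (u : ℕ) = n - 1 then if (i : ℕ) + 1 < k then f (i + 1) 0 else 0 else 0 := by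
  have inner (j : Fin k) : ∑ l : Fin n,
      algebraMap K (RatFunc K) (supN K k i j * eV K n u l) * f j l =
        if (i : ℕ) + 1 = j then if (u : ℕ) = n - 1 then f j 0 else 0 else 0 := by
    rw [Finset.sum_eq_single (⟨0, hn⟩ : Fin n)]
    · simp only [supN, eV, Matrix.of_apply]
      split_ifs <;> simp_all
    · intro l _ hl
      have : (l : ℕ) ≠ 0 := fun h => hl (Fin.ext h)
      simp [eV, this]
    · simp
  simp only [inner]
  split_ifs with hu hi
  · rw [Finset.sum_eq_single (⟨i + 1, hi⟩ : Fin k)]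
    · simp
    · intro j _ hj
      rw [if_neg fun h => hj (Fin.ext h.symm)]
    · simp
  · refine Finset.sum_eq_zero fun j _ => if_neg ?_
    have := j.isLt
    omega
  · simp

lemma sISub_jacobson_mul_apply {n k : ℕ} (hn : 1 ≤ n) (p : Polynomial K) (i : Fin k)
    (u : Fin n) {κ : Type*} (c : κ) (f : ℕ → ℕ → RatFunc K)
    (Z : Matrix (Fin k × Fin n) κ (RatFunc K)) (hZ : ∀ j l, Z (j, l) c = f j l) :
    (sISub (jacobson n p k) * Z) (i, u) c =
      RatFunc.X * f i u -
        ∑ l : Fin n, algebraMap K (RatFunc K) (companion n p u l) * f i l -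
      if (u : ℕ) = n - 1 then if (i : ℕ) + 1 < k then f (i + 1) 0 else 0 else 0 := by
  rw [← sum_supN_eV_mul hn i u f, sISub, Matrix.sub_mul, Matrix.sub_apply, Matrix.diagonal_mul,
    Matrix.mul_apply, Fintype.sum_prod_type, hZ, sub_sub]
  congr 1
  simp only [jacobson, Matrix.map_apply, Matrix.add_apply, Matrix.kroneckerMap_apply, map_add,
    add_mul, Finset.sum_add_distrib, hZ]
  congr 1
  rw [Finset.sum_eq_single i]
  · simp
  · intro j _ hj
    simp [Matrix.one_apply_ne hj.symm]
  · simp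

lemma sISub_jacobson_mul_jacobsonInv {n : ℕ} (hn : 1 ≤ n) {p : Polynomial K} (hp : p.Monic)
    (hdeg : p.natDegree = n) (k : ℕ) :
    sISub (jacobson n p k) * jacobsonInv n p k = 1 := by
  ext ⟨i, u⟩ ⟨j, v⟩
  rw [sISub_jacobson_mul_apply hn p i u (j, v) (fun i u =>
    blockCoeff p i j * (RatFunc.X ^ u * hankelVec n p v) -
      (if i = j then 1 else 0) * lowerToeplitz K u v) _
      (fun i u => by simp [jacobsonInv, Fin.ext_iff])]
  have hb := X_mul_pow_sub_sum_companion hp hdeg u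
  have hL := X_mul_lowerToeplitz_sub_sum_companion hp hdeg u v
  have hc := blockCoeff_mul hp.ne_zero (i := i) j.isLt
  have h0 : lowerToeplitz K 0 v = 0 := by simp [lowerToeplitz]
  have hone : (1 : Matrix (Fin k × Fin n) (Fin k × Fin n) (RatFunc K)) (i, u) (j, v) =
      (if (i : ℕ) = j then 1 else 0) * if u = v then 1 else 0 := by
    simp only [Matrix.one_apply, Prod.mk.injEq, Fin.ext_iff, ite_and]
    split_ifs <;> simp
  have hsum : ∑ l : Fin n, algebraMap K (RatFunc K) (companion n p u l) *
      (blockCoeff p i j * (RatFunc.X ^ (l : ℕ) * hankelVec n p v) -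
        (if (i : ℕ) = j then 1 else 0) * lowerToeplitz K l v) =
      blockCoeff p i j * hankelVec n p v *
        ∑ l : Fin n, algebraMap K (RatFunc K) (companion n p u l) * RatFunc.X ^ (l : ℕ) -
      (if (i : ℕ) = j then 1 else 0) *
        ∑ l : Fin n, algebraMap K (RatFunc K) (companion n p u l) * lowerToeplitz K l v := by
    rw [Finset.mul_sum, Finset.mul_sum, ← Finset.sum_sub_distrib]
    exact Finset.sum_congr rfl fun l _ => by ring
  have hcorner : (if (i : ℕ) + 1 < k then
      blockCoeff p (i + 1) j * (RatFunc.X ^ 0 * hankelVec n p v) -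
        (if (i : ℕ) + 1 = j then 1 else 0) * lowerToeplitz K 0 v else 0) =
      (if (i : ℕ) + 1 < k then blockCoeff p (i + 1) j else 0) * hankelVec n p v := by
    rw [h0]
    split_ifs <;> ring
  rw [hsum, hone, hcorner]
  by_cases h : (u : ℕ) = n - 1
  · simp only [if_pos h] at hb hL ⊢
    linear_combination blockCoeff p i j * hankelVec n p v * hb -
      (if (i : ℕ) = j then 1 else 0) * hL + hankelVec n p v * hc
  · simp only [if_neg h] at hb hL ⊢
    linear_combination blockCoeff p i j * hankelVec n p v * hb -
      (if (i : ℕ) = j then 1 else 0) * hL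

/-- The bilinear form of the inverse of `sI - J(p^k)` on coefficient vectors, modulo
polynomials. -/
lemma sum_blockCoeff_sub_sum_jacobsonInv_mem_range (n : ℕ) (p : Polynomial K) (k : ℕ)
    (x y : Fin k → Fin n → K) :
    (∑ i : Fin k, ∑ j : Fin k, blockCoeff p i j *
        ((∑ u : Fin n, algebraMap K (RatFunc K) (x i u) * RatFunc.X ^ (u : ℕ)) *
          ∑ v : Fin n, algebraMap K (RatFunc K) (y j v) * hankelVec n p v)) -
      (∑ iu : Fin k × Fin n, ∑ jv : Fin k × Fin n, algebraMap K (RatFunc K) (x iu.1 iu.2) *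
        jacobsonInv n p k iu jv * algebraMap K (RatFunc K) (y jv.1 jv.2)) ∈
      (algebraMap (Polynomial K) (RatFunc K)).range := by
  have hC (c : K) : algebraMap K (RatFunc K) c ∈
      (algebraMap (Polynomial K) (RatFunc K)).range :=
    ⟨Polynomial.C c, by simp [RatFunc.algebraMap_eq_C]⟩
  have key : (∑ i : Fin k, ∑ j : Fin k, blockCoeff p i j *
        ((∑ u : Fin n, algebraMap K (RatFunc K) (x i u) * RatFunc.X ^ (u : ℕ)) *
          ∑ v : Fin n, algebraMap K (RatFunc K) (y j v) * hankelVec n p v)) =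
      ∑ iu : Fin k × Fin n, ∑ jv : Fin k × Fin n, algebraMap K (RatFunc K) (x iu.1 iu.2) *
        (blockCoeff p iu.1 jv.1 * (RatFunc.X ^ (iu.2 : ℕ) * hankelVec n p jv.2)) *
          algebraMap K (RatFunc K) (y jv.1 jv.2) := by
    simp only [Fintype.sum_prod_type]
    refine Finset.sum_congr rfl fun i _ => ?_
    rw [Finset.sum_comm]
    refine Finset.sum_congr rfl fun j _ => ?_
    rw [Finset.sum_mul_sum, Finset.mul_sum]
    refine Finset.sum_congr rfl fun u _ => ?_
    rw [Finset.mul_sum]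
    exact Finset.sum_congr rfl fun v _ => by ring
  rw [key]
  simp only [← Finset.sum_sub_distrib, ← sub_mul, ← mul_sub, jacobsonInv, Matrix.of_apply,
    sub_sub_cancel]
  refine sum_mem fun iu _ => sum_mem fun jv _ => mul_mem (mul_mem (hC _) ?_) (hC _)
  split_ifs
  · exact lowerToeplitz_mem_range _ _
  · exact zero_mem _

lemma sum_range_mul_pow_eq {R : Type*} [CommSemiring R] (c : ℕ → R) (p : R) {k D : ℕ}
    (hk : k ≤ D) :
    ∃ r, ∑ i ∈ Finset.range D, c i * p ^ i = ∑ i ∈ Finset.range k, c i * p ^ i + p ^ k * r := by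
  obtain ⟨m, rfl⟩ := Nat.exists_eq_add_of_le hk
  refine ⟨∑ i ∈ Finset.range m, c (k + i) * p ^ i, ?_⟩
  rw [Finset.sum_range_add, Finset.mul_sum]
  congr 1
  exact Finset.sum_congr rfl fun i _ => by rw [pow_add]; ring

/-- The product of two `p`-adic expansions divided by `p^k`, modulo polynomials. -/
lemma mul_inv_pow_mul_sub_sum_blockCoeff_mem_range {p : Polynomial K} (hp : p ≠ 0)
    {k D : ℕ} (hD : k ≤ D) (x y : ℕ → Polynomial K) :
    algebraMap (Polynomial K) (RatFunc K) (∑ i ∈ Finset.range D, x i * p ^ i) *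
        ((algebraMap (Polynomial K) (RatFunc K) p) ^ k)⁻¹ *
        algebraMap (Polynomial K) (RatFunc K) (∑ i ∈ Finset.range D, y i * p ^ i) -
      ∑ i : Fin k, ∑ j : Fin k, blockCoeff p i j *
        (algebraMap (Polynomial K) (RatFunc K) (x i) *
          algebraMap (Polynomial K) (RatFunc K) (y (k - 1 - j))) ∈
      (algebraMap (Polynomial K) (RatFunc K)).range := by
  set φ := algebraMap (Polynomial K) (RatFunc K)
  have hP : φ p ≠ 0 := RatFunc.algebraMap_ne_zero hp
  obtain ⟨r, hr⟩ := sum_range_mul_pow_eq x p hD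
  obtain ⟨s, hs⟩ := sum_range_mul_pow_eq y p hD
  rw [hr, hs]
  set A := ∑ i ∈ Finset.range k, x i * p ^ i with hA
  set B := ∑ i ∈ Finset.range k, y i * p ^ i with hB
  have hsplit : φ (A + p ^ k * r) * (φ p ^ k)⁻¹ * φ (B + p ^ k * s) =
      φ (r * B + A * s + p ^ k * r * s) + φ A * (φ p ^ k)⁻¹ * φ B := by
    simp only [map_add, map_mul, map_pow]
    field_simp
    ring
  have hAB : φ A * (φ p ^ k)⁻¹ * φ B = ∑ i : Fin k, ∑ j : Fin k,
      φ (x i) * φ p ^ (i : ℕ) * (φ p ^ k)⁻¹ * (φ (y (k - 1 - j)) * φ p ^ (k - 1 - (j : ℕ))) := by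
    rw [hA, hB, ← Finset.sum_range_reflect (fun i => y i * p ^ i), Finset.sum_range,
      Finset.sum_range, map_sum, map_sum, Finset.sum_mul, Finset.sum_mul_sum]
    simp
  rw [hsplit, hAB, add_sub_assoc]
  refine add_mem ⟨_, rfl⟩ ?_
  simp only [← Finset.sum_sub_distrib]
  refine sum_mem fun i _ => sum_mem fun j _ => ?_
  have hj := j.isLt
  unfold blockCoeff
  split_ifs with hij
  · convert zero_mem φ.range using 1
    change _ - (φ p ^ ((j : ℕ) - i + 1))⁻¹ * _ = 0
    have hpow : φ p ^ k = φ p ^ (i : ℕ) * φ p ^ (k - 1 - (j : ℕ)) * φ p ^ ((j : ℕ) - i + 1) := by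
      rw [← pow_add, ← pow_add]; congr 1; omega
    rw [hpow]
    field_simp
    ring
  · refine ⟨x i * y (k - 1 - j) * p ^ ((i : ℕ) - j - 1), ?_⟩
    have hpow : φ p ^ (i : ℕ) * φ p ^ (k - 1 - (j : ℕ)) = φ p ^ k * φ p ^ ((i : ℕ) - j - 1) := by
      rw [← pow_add, ← pow_add]; congr 1; omega
    rw [zero_mul, sub_zero]
    simp only [map_mul, map_pow]
    field_simp
    linear_combination -(φ (x i) * φ (y (k - 1 - j)) * hpow)

/-- Theorem 4.1, realization formula: with `h`, `g` given by their
`p`-adic expansions `h = Σ hᵢ pⁱ`, `g = Σ gᵢ pⁱ` (all coefficient vectors of degree `< n`),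
and `Hᵢ`, `Gᵢ` the matrices determined by `hᵢ(s) = Hᵢ b(s)` and `gᵢ(s) = Gᵢ M b(s)`,
setting `H = (H₀, …, H_{k-1})` and `G = (G_{k-1}ᵀ; …; G₀ᵀ)`, one has
`π₋( h p^{-k} gᵀ ) = H (sI - J(p^k))⁻¹ G`. -/
theorem piMinus_realization_jacobson (n : ℕ) (hn : 1 ≤ n) (p : Polynomial K)
    (hp : p.Monic) (hirr : Irreducible p) (hdeg : p.natDegree = n)
    (k : ℕ) (hk : 1 ≤ k) (q t : ℕ)
    (h : Fin q → Polynomial K) (g : Fin t → Polynomial K)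
    (hcoef : ℕ → Fin q → Polynomial K) (gcoef : ℕ → Fin t → Polynomial K)
    (hcdeg : ∀ i a, (hcoef i a).degree < (n : ℕ)) (gcdeg : ∀ i b, (gcoef i b).degree < (n : ℕ))
    (D : ℕ) (hDk : k ≤ D)
    (hexp : ∀ a, h a = ∑ i ∈ Finset.range D, hcoef i a * p ^ i)
    (gexp : ∀ b, g b = ∑ i ∈ Finset.range D, gcoef i b * p ^ i)
    (Hmat : ℕ → Matrix (Fin q) (Fin n) K) (Gmat : ℕ → Matrix (Fin t) (Fin n) K)
    (hHmat : ∀ i a, hcoef i a = ∑ j : Fin n, Polynomial.C (Hmat i a j) * Polynomial.X ^ (j : ℕ))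
    (hGmat : ∀ i b, gcoef i b =
      ∑ j : Fin n, Polynomial.C ((Gmat i * hankelM n p) b j) * Polynomial.X ^ (j : ℕ)) :
    (Matrix.of fun (a : Fin q) (b : Fin t) =>
        piMinus (algebraMap (Polynomial K) (RatFunc K) (h a) *
          ((algebraMap (Polynomial K) (RatFunc K) p) ^ k)⁻¹ *
          algebraMap (Polynomial K) (RatFunc K) (g b))) =
      (Matrix.of fun (a : Fin q) (ij : Fin k × Fin n) =>
          algebraMap K (RatFunc K) (Hmat (ij.1 : ℕ) a ij.2)) *
        (sISub (jacobson n p k))⁻¹ *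
      (Matrix.of fun (ij : Fin k × Fin n) (b : Fin t) =>
          algebraMap K (RatFunc K) (Gmat (k - 1 - (ij.1 : ℕ)) b ij.2)) := by
  classical
  have hZ := sISub_jacobson_mul_jacobsonInv hn hp hdeg k
  rw [Matrix.inv_eq_right_inv hZ]
  ext a b
  set φ := algebraMap (Polynomial K) (RatFunc K)
  have hentry : ((Matrix.of fun (a : Fin q) (ij : Fin k × Fin n) =>
          algebraMap K (RatFunc K) (Hmat (ij.1 : ℕ) a ij.2)) * jacobsonInv n p k *
      (Matrix.of fun (ij : Fin k × Fin n) (b : Fin t) =>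
          algebraMap K (RatFunc K) (Gmat (k - 1 - (ij.1 : ℕ)) b ij.2))) a b =
      ∑ iu : Fin k × Fin n, ∑ jv : Fin k × Fin n,
        algebraMap K (RatFunc K) (Hmat (iu.1 : ℕ) a iu.2) * jacobsonInv n p k iu jv *
          algebraMap K (RatFunc K) (Gmat (k - 1 - (jv.1 : ℕ)) b jv.2) := by
    simp only [Matrix.mul_apply, Matrix.of_apply, Finset.sum_mul]
    exact Finset.sum_comm
  have hH (i : ℕ) : φ (hcoef i a) =
      ∑ u : Fin n, algebraMap K (RatFunc K) (Hmat i a u) * RatFunc.X ^ (u : ℕ) := by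
    simp [φ, hHmat, RatFunc.algebraMap_eq_C]
  have hG (i : ℕ) : φ (gcoef i b) =
      ∑ v : Fin n, algebraMap K (RatFunc K) (Gmat i b v) * hankelVec n p v := by
    simp only [hGmat, Matrix.mul_apply, ← sum_hankelM_eq_hankelVec, Finset.mul_sum, map_sum,
      map_mul, map_pow, Finset.sum_mul, φ, RatFunc.algebraMap_C, RatFunc.algebraMap_X,
      RatFunc.algebraMap_eq_C]
    rw [Finset.sum_comm]
    simp only [mul_assoc]
  rw [hentry, Matrix.of_apply]
  refine piMinus_eq_of_sub_mem_range ?_ ?_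
  · refine Valuation.map_sum_lt' _ zero_lt_one fun iu _ =>
      Valuation.map_sum_lt' _ zero_lt_one fun jv _ => ?_
    rw [map_mul, map_mul]
    refine (mul_le_of_le_one_right' (inftyValuation_algebraMap_le_one _)).trans_lt ?_
    exact (mul_le_of_le_one_left' (inftyValuation_algebraMap_le_one _)).trans_lt
      (inftyValuation_lt_one_of_sISub_mul_eq_one hZ iu jv)
  · have h1 := mul_inv_pow_mul_sub_sum_blockCoeff_mem_range hp.ne_zero hDk
      (fun i => hcoef i a) (fun i => gcoef i b)
    have h2 := sum_blockCoeff_sub_sum_jacobsonInv_mem_range n p k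
      (fun i u => Hmat i a u) (fun j v => Gmat (k - 1 - j) b v)
    simp only [← hH, ← hG] at h2
    rw [hexp, gexp]
    have h12 := add_mem h1 h2
    rwa [sub_add_sub_cancel] at h12

end
end

section
/- Let p be a monic irreducible polynomial of degree n over a field K, let k ≥ 1, and let h ∈ K[s]^q and g ∈ K[s]^t be nonzero polynomial vectors such that W = h · p^{−k} · gᵀ is a coprime factorization, i.e. p does not divide the gcd of the entries of h and p does not divide the gcd of the entries of g. Then every realization (F′, G′, H′) of π₋W (that is, F′ ∈ K^{m×m}, G′ ∈ K^{m×t}, H′ ∈ K^{q×m} with H′(sI − F′)^{−1}G′ = π₋W) has dimension m ≥ nk; consequently the realization of π₋W with state matrix J(p^k) constructed from the p-adic expansions of h and g is minimal. -/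
open Polynomial Matrix Kronecker

set_option synthInstance.maxHeartbeats 1000000
set_option maxHeartbeats 1000000

noncomputable section

variable {K : Type*} [Field K]

theorem piMinus_div {A Q : K[X]} (hQ : Q.Monic) :
    piMinus (algebraMap K[X] (RatFunc K) A / algebraMap K[X] (RatFunc K) Q) =
      algebraMap K[X] (RatFunc K) (A %ₘ Q) / algebraMap K[X] (RatFunc K) Q := by
  set f : RatFunc K := algebraMap K[X] (RatFunc K) A / algebraMap K[X] (RatFunc K) Q with hf
  have hQ0 : algebraMap K[X] (RatFunc K) Q ≠ 0 :=
    RatFunc.algebraMap_ne_zero hQ.ne_zero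
  obtain ⟨c, hc⟩ : f.denom ∣ Q := RatFunc.denom_div_dvd A Q
  have hd : f.denom.Monic := RatFunc.monic_denom f
  have hcm : c.Monic := hd.of_mul_monic_left (hc ▸ hQ)
  have hA : A = f.num * c := by
    have h1 : f.num * Q = A * f.denom := (RatFunc.num_mul_eq_mul_denom_iff hQ.ne_zero).2 hf
    rw [hc] at h1
    refine mul_right_cancel₀ hd.ne_zero (h1.symm.trans (by ring))
  have hquot : A /ₘ Q = f.num /ₘ f.denom := by
    refine (div_modByMonic_unique _ (c * (f.num %ₘ f.denom)) hQ ⟨?_, ?_⟩).1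
    · rw [hA, hc]
      conv_rhs => rw [← modByMonic_add_div f.num f.denom]
      ring
    · rw [hc, mul_comm, degree_mul, degree_mul]
      exact WithBot.add_lt_add_right (by simpa using hcm.ne_zero)
        (degree_modByMonic_lt _ hd)
  rw [piMinus, ← hquot, hf, div_sub' hQ0, ← map_mul, ← map_sub]
  congr 2
  exact (modByMonic_eq_sub_mul_div A Q).symm

theorem sISub_eq_map_charmatrix {ι : Type*} [Fintype ι] [DecidableEq ι] (F : Matrix ι ι K) :
    sISub F = F.charmatrix.map (algebraMap K[X] (RatFunc K)) := by
  ext i j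
  by_cases hij : i = j
  · subst hij
    simp [sISub, RatFunc.algebraMap_X, RatFunc.algebraMap_eq_C]
  · simp [sISub, hij, RatFunc.algebraMap_eq_C]

theorem map_algebraMap_eq {ι κ : Type*} (G : Matrix ι κ K) :
    G.map (algebraMap K (RatFunc K)) = (G.map C).map (algebraMap K[X] (RatFunc K)) := by
  ext i j
  simp [RatFunc.algebraMap_eq_C]

theorem isUnit_det_sISub {ι : Type*} [Fintype ι] [DecidableEq ι] (F : Matrix ι ι K) :
    IsUnit (sISub F).det := by
  rw [sISub_eq_map_charmatrix, ← RingHom.mapMatrix_apply, ← RingHom.map_det, isUnit_iff_ne_zero]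
  exact RatFunc.algebraMap_ne_zero F.charpoly_monic.ne_zero

/-- The transfer matrix times the characteristic polynomial is a polynomial matrix. -/
theorem exists_charpoly_smul_transfer {ι α β : Type*} [Fintype ι] [DecidableEq ι]
    (F : Matrix ι ι K) (G : Matrix ι β K) (H : Matrix α ι K) :
    ∃ P : Matrix α β K[X], algebraMap K[X] (RatFunc K) F.charpoly •
      (H.map (algebraMap K (RatFunc K)) * (sISub F)⁻¹ * G.map (algebraMap K (RatFunc K))) =
        P.map (algebraMap K[X] (RatFunc K)) := by
  refine ⟨H.map C * F.charmatrix.adjugate * G.map C, ?_⟩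
  have hdet : (sISub F).det = algebraMap K[X] (RatFunc K) F.charpoly := by
    rw [sISub_eq_map_charmatrix, ← RingHom.mapMatrix_apply, ← RingHom.map_det]; rfl
  have hne : algebraMap K[X] (RatFunc K) F.charpoly ≠ 0 := by
    rw [← hdet]; exact (isUnit_det_sISub F).ne_zero
  have hinv : algebraMap K[X] (RatFunc K) F.charpoly • (sISub F)⁻¹ =
      F.charmatrix.adjugate.map (algebraMap K[X] (RatFunc K)) := by
    rw [Matrix.inv_def, hdet, Ring.inverse_eq_inv', smul_smul, mul_inv_cancel₀ hne, one_smul,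
      sISub_eq_map_charmatrix, ← RingHom.mapMatrix_apply, ← RingHom.map_adjugate]
    rfl
  rw [← Matrix.smul_mul, ← Matrix.mul_smul, hinv, map_algebraMap_eq, map_algebraMap_eq,
    Matrix.map_mul, Matrix.map_mul]

theorem companion_mulVec_pow {n : ℕ} {p : K[X]} (hp : p.Monic) (hdeg : p.natDegree = n)
    (j : Fin n) :
    ∑ l : Fin n, C (companion n p j l) * X ^ (l : ℕ) =
      X * X ^ (j : ℕ) - if (j : ℕ) = n - 1 then p else 0 := by
  have hj := j.isLt
  by_cases hjn : (j : ℕ) = n - 1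
  · have hsum : p = X ^ n + ∑ i ∈ Finset.range n, C (p.coeff i) * X ^ i := by
      rw [← hdeg]; exact hp.as_sum
    have h1 : ∀ l : Fin n, C (companion n p j l) * X ^ (l : ℕ) =
        -(C (p.coeff l) * X ^ (l : ℕ)) := by
      intro l
      have : (j : ℕ) + 1 ≠ l := by omega
      rw [companion, Matrix.of_apply, if_neg this, if_pos hjn, C_neg, neg_mul]
    rw [Finset.sum_congr rfl fun l _ => h1 l, Finset.sum_neg_distrib,
      Fin.sum_univ_eq_sum_range (fun i => C (p.coeff i) * X ^ i), if_pos hjn, ← pow_succ',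
      show (j : ℕ) + 1 = n by omega]
    linear_combination hsum
  · rw [Finset.sum_eq_single (⟨j + 1, by omega⟩ : Fin n)]
    · simp [companion, hjn, pow_succ']
    · intro l _ hl
      have : (j : ℕ) + 1 ≠ l := fun h => hl (Fin.ext h.symm)
      simp [companion, this, hjn]
    · simp

/-- The polynomials `pⁱ sʲ`, forming a basis of the polynomials of degree less than `nk`. -/
def pAdicVec (n : ℕ) (p : K[X]) (k : ℕ) : Fin k × Fin n → K[X] :=
  fun x => p ^ (x.1 : ℕ) * X ^ (x.2 : ℕ)

/-- The last unit vector. -/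
def lastVec (K : Type*) [Field K] (n k : ℕ) : Fin k × Fin n → K :=
  fun x => if (x.1 : ℕ) = k - 1 ∧ (x.2 : ℕ) = n - 1 then 1 else 0

theorem jacobson_map_mulVec_pAdicVec {n : ℕ} {p : K[X]} (hp : p.Monic) (hdeg : p.natDegree = n)
    (k : ℕ) :
    (jacobson n p k).map C *ᵥ pAdicVec n p k =
      (X : K[X]) • pAdicVec n p k - p ^ k • (C ∘ lastVec K n k) := by
  ext1 ⟨i, j⟩
  have hi := i.isLt
  have hj := j.isLt
  have hV : ∑ l : Fin n, C (eV K n j l) * X ^ (l : ℕ) =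
      if (j : ℕ) = n - 1 then (1 : K[X]) else 0 := by
    rw [Finset.sum_eq_single (⟨0, by omega⟩ : Fin n)]
    · by_cases hjn : (j : ℕ) = n - 1 <;> simp [eV, hjn]
    · intro l _ hl
      have : (l : ℕ) ≠ 0 := fun h => hl (Fin.ext h)
      simp [eV, this]
    · simp
  have hN : ∑ m : Fin k, C (supN K k i m) * p ^ (m : ℕ) =
      if (i : ℕ) = k - 1 then 0 else p ^ ((i : ℕ) + 1) := by
    by_cases hik : (i : ℕ) = k - 1
    · rw [if_pos hik]
      refine Finset.sum_eq_zero fun m _ => ?_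
      have : (i : ℕ) + 1 ≠ m := by omega
      simp [supN, this]
    · rw [if_neg hik, Finset.sum_eq_single (⟨i + 1, by omega⟩ : Fin k)]
      · simp [supN]
      · intro m _ hm
        have : (i : ℕ) + 1 ≠ m := fun h => hm (Fin.ext h.symm)
        simp [supN, this]
      · simp
  have hexp : ((jacobson n p k).map C *ᵥ pAdicVec n p k) (i, j) =
      p ^ (i : ℕ) * (∑ l : Fin n, C (companion n p j l) * X ^ (l : ℕ)) +
      (∑ m : Fin k, C (supN K k i m) * p ^ (m : ℕ)) *
        (∑ l : Fin n, C (eV K n j l) * X ^ (l : ℕ)) := by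
    have h1 : p ^ (i : ℕ) = ∑ m : Fin k, C ((1 : Matrix (Fin k) (Fin k) K) i m) * p ^ (m : ℕ) := by
      rw [Finset.sum_eq_single i]
      · simp
      · intro m _ hm
        simp [Matrix.one_apply_ne hm.symm]
      · simp
    rw [h1, Finset.sum_mul_sum, Finset.sum_mul_sum, ← Finset.sum_add_distrib]
    simp only [Matrix.mulVec, dotProduct, Fintype.sum_prod_type, ← Finset.sum_add_distrib]
    refine Finset.sum_congr rfl fun m _ => Finset.sum_congr rfl fun l _ => ?_
    simp only [jacobson, pAdicVec, Matrix.map_apply, Matrix.add_apply, Matrix.kroneckerMap_apply,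
      map_add, map_mul]
    ring
  rw [hexp, companion_mulVec_pow hp hdeg, hN, hV]
  simp only [pAdicVec, lastVec, Pi.sub_apply, Pi.smul_apply, smul_eq_mul, Function.comp_apply]
  by_cases hjn : (j : ℕ) = n - 1
  · by_cases hik : (i : ℕ) = k - 1
    · have hpk : p ^ k = p ^ (k - 1) * p := by rw [← pow_succ]; congr 1; omega
      simp only [hjn, hik, if_true, and_self, map_one, hpk]
      ring
    · simp [hjn, hik]
      ring
  · simp [hjn]
    ring

theorem exists_aeval_map_mulVec_eq {ι : Type*} [Fintype ι] [DecidableEq ι] {J : Matrix ι ι K}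
    {v e : ι → K[X]} {Q : K[X]} (hJ : J.map C *ᵥ v = (X : K[X]) • v - Q • e) (g : K[X]) :
    ∃ z : ι → K[X], (aeval J g).map C *ᵥ v = g • v + Q • z := by
  induction g using Polynomial.induction_on with
  | C a =>
    refine ⟨0, ?_⟩
    ext1 i
    simp [Matrix.mulVec, dotProduct, Matrix.algebraMap_matrix_apply, apply_ite C, ite_mul]
  | add f g hf hg =>
    obtain ⟨z, hz⟩ := hf
    obtain ⟨w, hw⟩ := hg
    refine ⟨z + w, ?_⟩
    rw [map_add, Matrix.map_add _ (by simp), Matrix.add_mulVec, hz, hw, add_smul, smul_add]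
    abel
  | monomial d a hf =>
    obtain ⟨z, hz⟩ := hf
    refine ⟨(X : K[X]) • z - (aeval J (C a * X ^ d)).map C *ᵥ e, ?_⟩
    rw [pow_succ, ← mul_assoc, map_mul, aeval_X, Matrix.map_mul, ← Matrix.mulVec_mulVec, hJ,
      Matrix.mulVec_sub, Matrix.mulVec_smul, Matrix.mulVec_smul, hz, smul_add, smul_sub, smul_smul,
      smul_smul, smul_smul, mul_comm X, mul_comm X]
    abel

theorem charmatrix_mulVec_aeval_map_mulVec {ι : Type*} [Fintype ι] [DecidableEq ι]
    {J : Matrix ι ι K} {v : ι → K[X]} {e : ι → K} {Q : K[X]}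
    (hJ : J.map C *ᵥ v = (X : K[X]) • v - Q • (C ∘ e)) (g : K[X]) :
    J.charmatrix *ᵥ ((aeval J g).map C *ᵥ v) = Q • (C ∘ (aeval J g *ᵥ e)) := by
  have hchar : ∀ w, J.charmatrix *ᵥ w = (X : K[X]) • w - J.map C *ᵥ w := by
    intro w
    rw [charmatrix, Matrix.sub_mulVec, RingHom.mapMatrix_apply]
    congr 1
    ext1 i
    simp [Matrix.mulVec_diagonal]
  have hcomm : J.map C *ᵥ ((aeval J g).map C *ᵥ v) = (aeval J g).map C *ᵥ (J.map C *ᵥ v) := by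
    rw [Matrix.mulVec_mulVec, Matrix.mulVec_mulVec, ← Matrix.map_mul, ← Matrix.map_mul]
    congr 2
    simpa using congrArg (aeval J) (mul_comm X g)
  rw [hchar, hcomm, hJ, Matrix.mulVec_sub, Matrix.mulVec_smul, Matrix.mulVec_smul, sub_sub_cancel]
  congr 1
  ext1 i
  simp [Matrix.mulVec, dotProduct]

theorem exists_pAdic_coeffs {n : ℕ} {p : K[X]} (hp : p.Monic) (hdeg : p.natDegree = n)
    (k : ℕ) (r : K[X]) :
    ∃ c : Fin k × Fin n → K, p ^ k ∣ (C ∘ c) ⬝ᵥ pAdicVec n p k - r := by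
  have key : ∃ u : ℕ → K[X], (∀ i, (u i).degree < n) ∧
      p ^ k ∣ ∑ i ∈ Finset.range k, p ^ i * u i - r := by
    let w : ℕ → K[X] := fun i => Nat.rec r (fun _ a => a /ₘ p) i
    refine ⟨fun i => w i %ₘ p, fun i => ?_, ?_⟩
    · rw [← hdeg, ← degree_eq_natDegree hp.ne_zero]
      exact degree_modByMonic_lt _ hp
    · refine ⟨-w k, ?_⟩
      induction k with
      | zero => simp [w]
      | succ k ih =>
        have h1 : w k %ₘ p + p * w (k + 1) = w k := modByMonic_add_div _ _
        rw [Finset.sum_range_succ]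
        linear_combination ih + p ^ k * h1
  obtain ⟨u, hu, hdvd⟩ := key
  refine ⟨fun x => (u x.1).coeff x.2, ?_⟩
  convert hdvd using 2
  rw [dotProduct, Fintype.sum_prod_type,
    ← Fin.sum_univ_eq_sum_range (fun i => p ^ i * u i)]
  refine Finset.sum_congr rfl fun i _ => ?_
  have h2 : u i = ∑ j ∈ Finset.range n, C ((u i).coeff j) * X ^ j := by
    by_cases h0 : u i = 0
    · simp [h0]
    · exact as_sum_range_C_mul_X_pow' _ ((natDegree_lt_iff_degree_lt h0).2 (hu i))
  conv_rhs => rw [h2, ← Fin.sum_univ_eq_sum_range (fun j => C ((u i).coeff j) * X ^ j),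
    Finset.mul_sum]
  refine Finset.sum_congr rfl fun j _ => ?_
  simp only [pAdicVec, Function.comp_apply]
  ring

theorem degree_pAdicVec_lt {n : ℕ} {p : K[X]} (hp : p.Monic) (hdeg : p.natDegree = n)
    (k : ℕ) (x : Fin k × Fin n) : (pAdicVec n p k x).degree < (p ^ k).degree := by
  obtain ⟨i, j⟩ := x
  have hm : (pAdicVec n p k (i, j)).Monic := (hp.pow _).mul (monic_X_pow _)
  rw [degree_eq_natDegree hm.ne_zero, degree_eq_natDegree (hp.pow k).ne_zero, Nat.cast_lt,
    pAdicVec, (hp.pow _).natDegree_mul (monic_X_pow _), hp.natDegree_pow, hp.natDegree_pow,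
    natDegree_X_pow, hdeg]
  have hi : (i : ℕ) + 1 ≤ k := i.isLt
  have hj : (j : ℕ) < n := j.isLt
  nlinarith [Nat.mul_le_mul_right n hi]

theorem degree_dotProduct_lt {ι : Type*} [Fintype ι] {v : ι → K[X]} {Q : K[X]} (hQ : Q ≠ 0)
    (hv : ∀ i, (v i).degree < Q.degree) (c : ι → K) :
    ((C ∘ c) ⬝ᵥ v).degree < Q.degree := by
  rw [dotProduct]
  refine (degree_sum_le _ _).trans_lt ((Finset.sup_lt_iff ?_).2 fun i _ => ?_)
  · exact bot_lt_iff_ne_bot.2 (by simpa using hQ)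
  · rw [Function.comp_apply, ← smul_eq_C_mul]
    exact (degree_smul_le _ _).trans_lt (hv i)

theorem jacobson_realization {n : ℕ} {p : K[X]} (hp : p.Monic) (hdeg : p.natDegree = n)
    (k : ℕ) {α β : Type*} (h : α → K[X]) (g : β → K[X]) :
    ∃ (Hj : Matrix α (Fin k × Fin n) K) (Gj : Matrix (Fin k × Fin n) β K),
      Hj.map (algebraMap K (RatFunc K)) * (sISub (jacobson n p k))⁻¹ *
          Gj.map (algebraMap K (RatFunc K)) =
        Matrix.of fun a b => algebraMap K[X] (RatFunc K) ((h a * g b) %ₘ p ^ k) /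
          algebraMap K[X] (RatFunc K) (p ^ k) := by
  have hQ : (p ^ k).Monic := hp.pow k
  have hQ0 : algebraMap K[X] (RatFunc K) (p ^ k) ≠ 0 := RatFunc.algebraMap_ne_zero hQ.ne_zero
  set J := jacobson n p k
  set v := pAdicVec n p k
  have hJ := jacobson_map_mulVec_pAdicVec hp hdeg k
  choose c hc using fun a => exists_pAdic_coeffs hp hdeg k (h a)
  choose z hz using fun b => exists_aeval_map_mulVec_eq hJ (g b)
  let Hj : Matrix α (Fin k × Fin n) K := Matrix.of c
  let Gj : Matrix (Fin k × Fin n) β K := Matrix.of fun x b => (aeval J (g b) *ᵥ lastVec K n k) x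
  let Y : Matrix (Fin k × Fin n) β K[X] := Matrix.of fun x b => ((aeval J (g b)).map C *ᵥ v) x
  have hY : J.charmatrix * Y = p ^ k • Gj.map C := by
    ext1 x b
    exact congrFun (charmatrix_mulVec_aeval_map_mulVec hJ (g b)) x
  have hinv : (sISub J)⁻¹ * Gj.map (algebraMap K (RatFunc K)) =
      (algebraMap K[X] (RatFunc K) (p ^ k))⁻¹ • Y.map (algebraMap K[X] (RatFunc K)) := by
    have h1 : sISub J * Y.map (algebraMap K[X] (RatFunc K)) =
        algebraMap K[X] (RatFunc K) (p ^ k) • Gj.map (algebraMap K (RatFunc K)) := by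
      rw [sISub_eq_map_charmatrix, ← Matrix.map_mul, hY, map_algebraMap_eq]
      ext1 x b
      simp
    rw [← Matrix.nonsing_inv_mul_cancel_left (sISub J) (Y.map _) (isUnit_det_sISub J), h1,
      Matrix.mul_smul, smul_smul, inv_mul_cancel₀ hQ0, one_smul]
  refine ⟨Hj, Gj, ?_⟩
  rw [Matrix.mul_assoc, hinv, Matrix.mul_smul, map_algebraMap_eq, ← Matrix.map_mul]
  ext1 a b
  rw [Matrix.smul_apply, Matrix.map_apply, Matrix.of_apply, smul_eq_mul, mul_comm, ← div_eq_mul_inv]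
  congr 2
  have hentry : (Hj.map C * Y) a b = (C ∘ c a) ⬝ᵥ ((aeval J (g b)).map C *ᵥ v) := rfl
  rw [hentry]
  have hdlt : ((C ∘ c a) ⬝ᵥ ((aeval J (g b)).map C *ᵥ v)).degree < (p ^ k).degree :=
    degree_dotProduct_lt hQ.ne_zero
      (fun x => degree_dotProduct_lt hQ.ne_zero (degree_pAdicVec_lt hp hdeg k) _) _
  rw [← (modByMonic_eq_self_iff hQ).2 hdlt]
  refine modByMonic_eq_of_dvd_sub hQ ?_
  rw [hz, dotProduct_add, dotProduct_smul, dotProduct_smul, smul_eq_mul, smul_eq_mul]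
  obtain ⟨d, hd⟩ := hc a
  refine ⟨g b * d + (C ∘ c a) ⬝ᵥ z b, ?_⟩
  linear_combination g b * hd

open Classical

/-- minimality: if `W = h p^{-k} gᵀ` is a coprime factorization
(`p` divides neither the gcd of the entries of `h` nor of `g`), then every
realization of `π₋ W` has dimension at least `nk`; consequently any realization
of `π₋ W` with state matrix `J(p^k)` is minimal. -/
theorem realization_dim_ge_of_coprime (n : ℕ) (hn : 1 ≤ n) (p : Polynomial K)
    (hp : p.Monic) (hirr : Irreducible p) (hdeg : p.natDegree = n)
    (k : ℕ) (hk : 1 ≤ k) (q t : ℕ)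
    (h : Fin q → Polynomial K) (g : Fin t → Polynomial K)
    (hh : h ≠ 0) (hg : g ≠ 0)
    (hcop : ¬ p ∣ Finset.univ.gcd h) (gcop : ¬ p ∣ Finset.univ.gcd g) :
    (∀ (m : ℕ) (F' : Matrix (Fin m) (Fin m) K) (G' : Matrix (Fin m) (Fin t) K)
        (H' : Matrix (Fin q) (Fin m) K),
        H'.map (algebraMap K (RatFunc K)) * (sISub F')⁻¹ *
            G'.map (algebraMap K (RatFunc K)) =
          (Matrix.of fun (a : Fin q) (b : Fin t) =>
            piMinus (algebraMap (Polynomial K) (RatFunc K) (h a) *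
              ((algebraMap (Polynomial K) (RatFunc K) p) ^ k)⁻¹ *
              algebraMap (Polynomial K) (RatFunc K) (g b))) →
        n * k ≤ m) ∧
    ∃ (Hj : Matrix (Fin q) (Fin k × Fin n) K) (Gj : Matrix (Fin k × Fin n) (Fin t) K),
      Hj.map (algebraMap K (RatFunc K)) * (sISub (jacobson n p k))⁻¹ *
          Gj.map (algebraMap K (RatFunc K)) =
        (Matrix.of fun (a : Fin q) (b : Fin t) =>
          piMinus (algebraMap (Polynomial K) (RatFunc K) (h a) *
            ((algebraMap (Polynomial K) (RatFunc K) p) ^ k)⁻¹ *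
            algebraMap (Polynomial K) (RatFunc K) (g b))) := by
  have hQ : (p ^ k).Monic := hp.pow k
  have hW : (Matrix.of fun (a : Fin q) (b : Fin t) =>
        piMinus (algebraMap (Polynomial K) (RatFunc K) (h a) *
          ((algebraMap (Polynomial K) (RatFunc K) p) ^ k)⁻¹ *
          algebraMap (Polynomial K) (RatFunc K) (g b))) =
      Matrix.of fun a b => algebraMap K[X] (RatFunc K) ((h a * g b) %ₘ p ^ k) /
        algebraMap K[X] (RatFunc K) (p ^ k) := by
    ext1 a b
    rw [Matrix.of_apply, Matrix.of_apply, ← piMinus_div hQ, map_mul, map_pow, mul_right_comm,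
      div_eq_mul_inv]
  rw [hW]
  refine ⟨fun m F' G' H' hreal => ?_, jacobson_realization hp hdeg k h g⟩
  simp only [Finset.dvd_gcd_iff, Finset.mem_univ, true_implies, not_forall] at hcop gcop
  obtain ⟨a, ha⟩ := hcop
  obtain ⟨b, hb⟩ := gcop
  obtain ⟨P, hP⟩ := exists_charpoly_smul_transfer F' G' H'
  have hab := congrFun (congrFun hP a) b
  rw [hreal, Matrix.smul_apply, Matrix.of_apply, Matrix.map_apply, smul_eq_mul, ← mul_div_assoc,
    div_eq_iff (RatFunc.algebraMap_ne_zero hQ.ne_zero), ← map_mul, ← map_mul] at hab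
  have hpoly := RatFunc.algebraMap_injective K hab
  have hnd : ¬ p ∣ (h a * g b) %ₘ p ^ k := by
    intro hdvd
    have h1 : p ∣ h a * g b := by
      rw [← modByMonic_add_div (h a * g b) (p ^ k)]
      exact dvd_add hdvd ((dvd_pow_self p (by omega)).mul_right _)
    exact (hirr.prime.dvd_or_dvd h1).elim ha hb
  have hcp : p ^ k ∣ F'.charpoly :=
    ((hirr.coprime_iff_not_dvd.2 hnd).pow_left).dvd_of_dvd_mul_right ⟨P a b, by rw [hpoly, mul_comm]⟩
  have hle := natDegree_le_of_dvd hcp F'.charpoly_monic.ne_zero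
  rwa [hp.natDegree_pow, hdeg, Matrix.charpoly_natDegree_eq_dim, Fintype.card_fin, mul_comm] at hle

end
end

section
/- Let p be a monic irreducible polynomial of degree n over a field K with companion matrix C. Then, over K(s), the matrix sI − C is invertible and (sI − C)^{−1} = π₋( p^{−1} · b(s) b(s)ᵀ M ), where π₋ is applied entrywise. -/
open Polynomial Matrix Kronecker

set_option synthInstance.maxHeartbeats 1000000
set_option maxHeartbeats 1000000

noncomputable section

variable {K : Type*} [Field K]

theorem RatFunc.num_divByMonic_denom_div (f : K[X]) {p : K[X]} (hp : p.Monic) :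
    (algebraMap K[X] (RatFunc K) f / algebraMap K[X] (RatFunc K) p).num /ₘ
      (algebraMap K[X] (RatFunc K) f / algebraMap K[X] (RatFunc K) p).denom = f /ₘ p := by
  obtain ⟨c, hc⟩ := RatFunc.denom_div_dvd f p
  have hnd : (algebraMap K[X] (RatFunc K) f / algebraMap K[X] (RatFunc K) p).num * p =
      f * (algebraMap K[X] (RatFunc K) f / algebraMap K[X] (RatFunc K) p).denom :=
    (RatFunc.num_mul_eq_mul_denom_iff hp.ne_zero).2 rfl
  set g := algebraMap K[X] (RatFunc K) f / algebraMap K[X] (RatFunc K) p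
  have hd : g.denom.Monic := RatFunc.monic_denom g
  have hf : f = g.num * c := by
    apply mul_right_cancel₀ hd.ne_zero
    rw [← hnd, hc]; ring
  have hc0 : c ≠ 0 := by
    rintro rfl
    exact hp.ne_zero (by simpa using hc)
  refine ((div_modByMonic_unique (g.num /ₘ g.denom) (c * (g.num %ₘ g.denom)) hp ⟨?_, ?_⟩).1).symm
  · conv_rhs => rw [hf, ← modByMonic_add_div g.num g.denom]
    rw [hc]; ring
  · rw [hc, mul_comm g.denom, degree_mul, degree_mul]
    exact WithBot.add_lt_add_left (degree_ne_bot.mpr hc0) (degree_modByMonic_lt _ hd)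

theorem piMinus_inv_mul_algebraMap (f : K[X]) {p : K[X]} (hp : p.Monic) :
    piMinus ((algebraMap K[X] (RatFunc K) p)⁻¹ * algebraMap K[X] (RatFunc K) f) =
      (algebraMap K[X] (RatFunc K) p)⁻¹ * algebraMap K[X] (RatFunc K) (f %ₘ p) := by
  have hp0 : algebraMap K[X] (RatFunc K) p ≠ 0 := RatFunc.algebraMap_ne_zero hp.ne_zero
  rw [inv_mul_eq_div, piMinus, RatFunc.num_divByMonic_denom_div f hp, modByMonic_eq_sub_mul_div,
    map_sub, map_mul]
  field_simp

/-- The `j`-th entry of `b(s)ᵀ M(p)`, as a polynomial. -/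
def hankelPoly (n : ℕ) (p : K[X]) (j : Fin n) : K[X] :=
  ∑ k : Fin n, X ^ (k : ℕ) * C (hankelM n p k j)

theorem coeff_hankelPoly {n : ℕ} {p : K[X]} (hdeg : p.natDegree = n) (j : Fin n) (m : ℕ) :
    (hankelPoly n p j).coeff m = p.coeff (m + j + 1) := by
  have key : (hankelPoly n p j).coeff m = ∑ k : Fin n, if m = (k : ℕ) then hankelM n p k j else 0 := by
    simp [hankelPoly, coeff_X_pow]
  rw [key]
  by_cases hm : m < n
  · rw [Finset.sum_eq_single ⟨m, hm⟩]
    · simp only [hankelM, Matrix.of_apply, if_true]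
      split_ifs with h
      · rfl
      · exact (coeff_eq_zero_of_natDegree_lt (by omega)).symm
    · intro b _ hb
      exact if_neg fun h => hb (Fin.ext h.symm)
    · simp
  · rw [coeff_eq_zero_of_natDegree_lt (by omega)]
    exact Finset.sum_eq_zero fun k _ => if_neg (by omega)

theorem degree_sub_X_pow_mul_hankelPoly_lt {n : ℕ} {p : K[X]} (hdeg : p.natDegree = n)
    (j : Fin n) : (p - X ^ ((j : ℕ) + 1) * hankelPoly n p j).degree < (((j : ℕ) + 1 : ℕ) : WithBot ℕ) := by
  rw [degree_lt_iff_coeff_zero]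
  intro m hm
  obtain ⟨d, rfl⟩ := Nat.exists_eq_add_of_le' hm
  rw [coeff_sub, coeff_X_pow_mul, coeff_hankelPoly hdeg, add_assoc, sub_self]

theorem X_pow_mul_hankelPoly_modByMonic_of_le {n : ℕ} {p : K[X]} (hp : p.Monic)
    (hdeg : p.natDegree = n) {i : ℕ} {j : Fin n} (hij : i ≤ j) :
    (X ^ i * hankelPoly n p j) %ₘ p = X ^ i * hankelPoly n p j := by
  rw [modByMonic_eq_self_iff hp, degree_eq_natDegree hp.ne_zero, hdeg, degree_lt_iff_coeff_zero]
  intro m hm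
  obtain ⟨d, rfl⟩ := Nat.exists_eq_add_of_le' (show i ≤ m by omega)
  rw [coeff_X_pow_mul, coeff_hankelPoly hdeg]
  exact coeff_eq_zero_of_natDegree_lt (by omega)

theorem X_pow_mul_hankelPoly_modByMonic_of_lt {n : ℕ} {p : K[X]} (hp : p.Monic)
    (hdeg : p.natDegree = n) {i : ℕ} {j : Fin n} (hij : (j : ℕ) < i) (hi : i ≤ n) :
    (X ^ i * hankelPoly n p j) %ₘ p =
      -(X ^ (i - (j + 1)) * (p - X ^ ((j : ℕ) + 1) * hankelPoly n p j)) := by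
  refine (div_modByMonic_unique (X ^ (i - (j + 1))) _ hp ⟨?_, ?_⟩).2
  · obtain ⟨d, rfl⟩ := Nat.exists_eq_add_of_le' (Nat.succ_le_of_lt hij)
    simp only [Nat.succ_eq_add_one, Nat.add_sub_cancel]
    ring
  · rw [degree_neg, degree_eq_natDegree hp.ne_zero, hdeg, degree_lt_iff_coeff_zero]
    intro m hm
    obtain ⟨d, rfl⟩ := Nat.exists_eq_add_of_le' (show i - (j + 1) ≤ m by omega)
    rw [coeff_X_pow_mul]
    have hd : (j : ℕ) + 1 ≤ d := by omega
    exact (degree_lt_iff_coeff_zero _ _).1 (degree_sub_X_pow_mul_hankelPoly_lt hdeg j) d hd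

theorem X_mul_modByMonic_sub_modByMonic {n : ℕ} {p : K[X]} (hp : p.Monic)
    (hdeg : p.natDegree = n) (i j : Fin n) :
    X * ((X ^ (i : ℕ) * hankelPoly n p j) %ₘ p) - (X ^ ((i : ℕ) + 1) * hankelPoly n p j) %ₘ p =
      if i = j then p else 0 := by
  rcases lt_trichotomy i j with h | rfl | h
  · rw [X_pow_mul_hankelPoly_modByMonic_of_le hp hdeg (Fin.lt_def.1 h).le,
      X_pow_mul_hankelPoly_modByMonic_of_le hp hdeg (Fin.lt_def.1 h), if_neg h.ne]
    rw [Nat.succ_eq_add_one, pow_succ]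
    ring
  · rw [X_pow_mul_hankelPoly_modByMonic_of_le hp hdeg le_rfl,
      X_pow_mul_hankelPoly_modByMonic_of_lt hp hdeg (Nat.lt_succ_self _) i.2, if_pos rfl]
    simp only [Nat.sub_self]
    ring
  · have h' := Fin.lt_def.1 h
    rw [X_pow_mul_hankelPoly_modByMonic_of_lt hp hdeg h' i.2.le,
      X_pow_mul_hankelPoly_modByMonic_of_lt hp hdeg (h'.trans (Nat.lt_succ_self _)) i.2,
      if_neg h.ne', Nat.sub_add_comm (n := (i : ℕ)) (m := 1) (Nat.succ_le_of_lt h'), pow_succ]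
    ring

theorem sum_companion_mul_modByMonic {n : ℕ} {p : K[X]} (hp : p.Monic)
    (hdeg : p.natDegree = n) (i : Fin n) (q : K[X]) :
    ∑ k : Fin n, C (companion n p i k) * ((X ^ (k : ℕ) * q) %ₘ p) =
      (X ^ ((i : ℕ) + 1) * q) %ₘ p := by
  by_cases hi : (i : ℕ) + 1 < n
  · rw [Finset.sum_eq_single ⟨i + 1, hi⟩]
    · simp [companion]
    · intro b _ hb
      have h1 : (i : ℕ) + 1 ≠ b := fun h => hb (Fin.ext h.symm)
      have h2 : (i : ℕ) ≠ n - 1 := by omega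
      simp [companion, h1, h2]
    · simp
  · have hin : (i : ℕ) + 1 = n := by omega
    have hentry (k : Fin n) : companion n p i k = -p.coeff k := by
      have h1 : (i : ℕ) + 1 ≠ k := by omega
      have h2 : (i : ℕ) = n - 1 := by omega
      simp only [companion, Matrix.of_apply, if_neg h1, if_pos h2]
    have hsum : X ^ n * q = p * q + ∑ k : Fin n, C (companion n p i k) * (X ^ (k : ℕ) * q) := by
      conv_rhs => enter [1]; rw [hp.as_sum, hdeg, ← Fin.sum_univ_eq_sum_range
        (fun k => C (p.coeff k) * X ^ k)]
      simp only [hentry, map_neg, neg_mul, Finset.sum_neg_distrib, add_mul, Finset.sum_mul,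
        mul_assoc, add_neg_cancel_right]
    rw [hin, hsum, add_modByMonic, (modByMonic_eq_zero_iff_dvd hp).2 (dvd_mul_right p q), zero_add]
    change _ = modByMonicHom p _
    simp only [map_sum, C_mul', map_smul]
    rfl

theorem bbT_mul_hankelM_apply (n : ℕ) (p : K[X]) (i j : Fin n) :
    (bbT K n * (hankelM n p).map (algebraMap K (RatFunc K))) i j =
      algebraMap K[X] (RatFunc K) (X ^ (i : ℕ) * hankelPoly n p j) := by
  simp only [Matrix.mul_apply, Matrix.map_apply, bbT, Matrix.of_apply, bVec, hankelPoly,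
    Finset.mul_sum, map_sum, map_mul, map_pow, mul_assoc, RatFunc.algebraMap_X,
    RatFunc.algebraMap_C, RatFunc.algebraMap_eq_C]

theorem sISub_companion_mul_piMinus (n : ℕ) {p : K[X]} (hp : p.Monic) (hdeg : p.natDegree = n) :
    sISub (companion n p) * (((algebraMap K[X] (RatFunc K) p)⁻¹ •
      (bbT K n * (hankelM n p).map (algebraMap K (RatFunc K))))).map piMinus = 1 := by
  have hp0 : algebraMap K[X] (RatFunc K) p ≠ 0 := RatFunc.algebraMap_ne_zero hp.ne_zero
  ext i j
  have hmain := congrArg (algebraMap K[X] (RatFunc K))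
    (X_mul_modByMonic_sub_modByMonic hp hdeg i j)
  rw [← sum_companion_mul_modByMonic hp hdeg i] at hmain
  simp only [map_sub, map_mul, map_sum, RatFunc.algebraMap_X, RatFunc.algebraMap_C] at hmain
  rw [sISub, Matrix.sub_mul, Matrix.sub_apply, Matrix.diagonal_mul, Matrix.mul_apply]
  simp only [Matrix.map_apply, Matrix.smul_apply, smul_eq_mul, bbT_mul_hankelM_apply,
    piMinus_inv_mul_algebraMap _ hp, mul_left_comm _ (algebraMap K[X] (RatFunc K) p)⁻¹]
  simp only [RatFunc.algebraMap_eq_C]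
  rw [← Finset.mul_sum, ← mul_sub, hmain, Matrix.one_apply]
  split_ifs <;> simp [hp0]

/-- `(sI - C)` is invertible over `K(s)` and
`(sI - C)⁻¹ = π₋( p⁻¹ b(s) b(s)ᵀ M )`, entrywise. -/
theorem companion_resolvent_eq_piMinus (n : ℕ) (hn : 1 ≤ n) (p : Polynomial K)
    (hp : p.Monic) (hirr : Irreducible p) (hdeg : p.natDegree = n) :
    IsUnit (sISub (companion n p)) ∧
    (sISub (companion n p))⁻¹ =
      (((algebraMap (Polynomial K) (RatFunc K) p)⁻¹ •
        (bbT K n * (hankelM n p).map (algebraMap K (RatFunc K))))).map piMinus := by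
  have h := sISub_companion_mul_piMinus n hp hdeg
  exact ⟨IsUnit.of_mul_eq_one _ h, Matrix.inv_eq_right_inv h⟩

end
end

section
/- Let p be a monic polynomial of degree n over a field K with companion matrix C and Hankel matrix M. Then, over K(s), e_1ᵀ (sI − C)^{−1} = p^{−1} b(s)ᵀ M, where e_1 = (1, 0, …, 0)ᵀ ∈ K^n. -/
open Polynomial Matrix Kronecker

set_option synthInstance.maxHeartbeats 1000000
set_option maxHeartbeats 1000000

noncomputable section

variable {K : Type*} [Field K]

theorem det_sISub_ne_zero {ι : Type*} [Fintype ι] [DecidableEq ι] (F : Matrix ι ι K) :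
    (sISub F).det ≠ 0 := by
  have h : sISub F = F.charmatrix.map (algebraMap (Polynomial K) (RatFunc K)) := by
    ext i j
    by_cases hij : i = j
    · subst hij
      simp [sISub]
    · simp [sISub, hij]
  rw [h, ← RingHom.mapMatrix_apply, ← RingHom.map_det]
  exact (map_ne_zero_iff _ (RatFunc.algebraMap_injective K)).2 F.charpoly_monic.ne_zero

/-- The `j`-th entry of `b(s)ᵀ M(p)`, defined for all `j : ℕ`. -/
def hankelEntry (n : ℕ) (p : Polynomial K) (j : ℕ) : RatFunc K :=
  ∑ i ∈ Finset.range n, RatFunc.X ^ i * algebraMap K (RatFunc K) (p.coeff (i + j + 1))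

theorem bVec_vecMul_hankelM (n : ℕ) (p : Polynomial K) (hdeg : p.natDegree = n) (j : Fin n) :
    (bVec K n ᵥ* (hankelM n p).map (algebraMap K (RatFunc K))) j = hankelEntry n p j := by
  rw [hankelEntry, ← Fin.sum_univ_eq_sum_range
    (fun i => (RatFunc.X : RatFunc K) ^ i * algebraMap K (RatFunc K) (p.coeff (i + j + 1)))]
  simp only [vecMul, dotProduct]
  refine Finset.sum_congr rfl fun i _ => ?_
  simp only [bVec, hankelM, map_apply, of_apply]
  split_ifs with h
  · rfl
  · rw [p.coeff_eq_zero_of_natDegree_lt (by omega)]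

theorem X_mul_hankelEntry_add (n : ℕ) (p : Polynomial K) (j : ℕ) :
    RatFunc.X * hankelEntry n p j + algebraMap K (RatFunc K) (p.coeff j) =
      ∑ i ∈ Finset.range (n + 1), RatFunc.X ^ i * algebraMap K (RatFunc K) (p.coeff (i + j)) := by
  rw [Finset.sum_range_succ', hankelEntry, Finset.mul_sum]
  simp only [pow_zero, one_mul, zero_add]
  congr 1
  refine Finset.sum_congr rfl fun i _ => ?_
  rw [show i + 1 + j = i + j + 1 by omega]
  ring

theorem X_mul_hankelEntry_zero_add (n : ℕ) (p : Polynomial K) (hdeg : p.natDegree = n) :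
    RatFunc.X * hankelEntry n p 0 + algebraMap K (RatFunc K) (p.coeff 0) =
      algebraMap (Polynomial K) (RatFunc K) p := by
  rw [X_mul_hankelEntry_add]
  conv_rhs => rw [p.as_sum_range_C_mul_X_pow, hdeg, map_sum]
  refine Finset.sum_congr rfl fun i _ => ?_
  rw [map_mul, map_pow, RatFunc.algebraMap_X, RatFunc.algebraMap_C, RatFunc.algebraMap_eq_C,
    mul_comm, add_zero]

theorem X_mul_hankelEntry_succ_add (n : ℕ) (p : Polynomial K) (hdeg : p.natDegree = n) (j : ℕ) :
    RatFunc.X * hankelEntry n p (j + 1) + algebraMap K (RatFunc K) (p.coeff (j + 1)) =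
      hankelEntry n p j := by
  rw [X_mul_hankelEntry_add, Finset.sum_range_succ,
    p.coeff_eq_zero_of_natDegree_lt (by omega : p.natDegree < n + (j + 1))]
  simp [hankelEntry, add_assoc]

theorem hankelEntry_last (m : ℕ) (p : Polynomial K) (hp : p.Monic)
    (hdeg : p.natDegree = m + 1) : hankelEntry (m + 1) p m = 1 := by
  rw [hankelEntry, Finset.sum_range_succ', Finset.sum_eq_zero fun i _ => ?_]
  · simp [← hdeg, hp.coeff_natDegree]
  · rw [p.coeff_eq_zero_of_natDegree_lt (by omega)]
    simp

theorem sISub_companion_apply (m : ℕ) (p : Polynomial K) (i j : Fin (m + 1)) :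
    sISub (companion (m + 1) p) i j =
      (if (i : ℕ) = j then RatFunc.X else 0) - (if (i : ℕ) + 1 = j then 1 else 0) +
        (if (i : ℕ) = m then algebraMap K (RatFunc K) (p.coeff j) else 0) := by
  have hj := j.isLt
  simp only [sISub, companion, Matrix.sub_apply, map_apply, of_apply, diagonal_apply, Fin.ext_iff,
    Nat.add_sub_cancel]
  split_ifs <;> first | omega | simp

theorem hankelEntry_vecMul_sISub_companion (m : ℕ) (p : Polynomial K) (hp : p.Monic)
    (hdeg : p.natDegree = m + 1) :
    (fun i : Fin (m + 1) => hankelEntry (m + 1) p i) ᵥ* sISub (companion (m + 1) p) =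
      fun i : Fin (m + 1) =>
        if (i : ℕ) = 0 then algebraMap (Polynomial K) (RatFunc K) p else 0 := by
  ext ⟨j, hj⟩
  simp only [vecMul, dotProduct, sISub_companion_apply]
  rw [Fin.sum_univ_eq_sum_range (fun i => hankelEntry (m + 1) p i *
    ((if i = j then RatFunc.X else 0) - (if i + 1 = j then 1 else 0) +
      (if i = m then algebraMap K (RatFunc K) (p.coeff j) else 0)))]
  simp only [mul_add, mul_sub, Finset.sum_add_distrib, Finset.sum_sub_distrib, mul_ite, mul_zero,
    mul_one, Finset.sum_ite_eq', Finset.mem_range, hj, Nat.lt_succ_self, if_true,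
    hankelEntry_last m p hp hdeg, one_mul]
  cases j with
  | zero =>
    rw [← X_mul_hankelEntry_zero_add (m + 1) p hdeg]
    simp [mul_comm]
  | succ k =>
    have hk : k < m + 1 := by omega
    have h := X_mul_hankelEntry_succ_add (m + 1) p hdeg k
    simp only [Nat.add_right_cancel_iff, Finset.sum_ite_eq', Finset.mem_range, hk, if_true,
      Nat.succ_ne_zero, if_false]
    rw [← h]
    ring

/-- `e₁ᵀ (sI - C)⁻¹ = p⁻¹ b(s)ᵀ M` over `K(s)`. -/
theorem e1_vecMul_companion_resolvent (n : ℕ) (hn : 1 ≤ n) (p : Polynomial K)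
    (hp : p.Monic) (hdeg : p.natDegree = n) :
    (fun i : Fin n => if (i : ℕ) = 0 then (1 : RatFunc K) else 0) ᵥ*
        (sISub (companion n p))⁻¹ =
      fun j : Fin n => (algebraMap (Polynomial K) (RatFunc K) p)⁻¹ *
        ((bVec K n) ᵥ* ((hankelM n p).map (algebraMap K (RatFunc K)))) j := by
  obtain ⟨m, rfl⟩ : ∃ m, n = m + 1 := ⟨n - 1, by omega⟩
  have hunit : IsUnit (sISub (companion (m + 1) p)).det := (det_sISub_ne_zero _).isUnit
  have hp0 : algebraMap (Polynomial K) (RatFunc K) p ≠ 0 :=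
    (map_ne_zero_iff _ (RatFunc.algebraMap_injective K)).2 hp.ne_zero
  have key : (fun i : Fin (m + 1) => if (i : ℕ) = 0 then (1 : RatFunc K) else 0) =
      ((algebraMap (Polynomial K) (RatFunc K) p)⁻¹ •
        fun i : Fin (m + 1) => hankelEntry (m + 1) p i) ᵥ* sISub (companion (m + 1) p) := by
    rw [smul_vecMul, hankelEntry_vecMul_sISub_companion m p hp hdeg]
    ext i
    simp [hp0]
  rw [key, vecMul_vecMul, mul_nonsing_inv _ hunit, vecMul_one]
  ext j
  rw [bVec_vecMul_hankelM _ p hdeg, Pi.smul_apply, smul_eq_mul]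

end
end

section
/- Let p be a monic polynomial of degree n over a field K with companion matrix C, let V = e_n e_1ᵀ ∈ K^{n×n}, and let k ≥ 1. Set Q = V (sI − C)^{−1} over K(s). Then sI − J(p^k) is invertible over K(s) and, writing its inverse as a k×k array of n×n blocks, the (i,j) block equals (sI − C)^{−1} Q^{j−i} for i ≤ j and the zero matrix for i > j. -/
open Polynomial Matrix Kronecker

set_option synthInstance.maxHeartbeats 1000000
set_option maxHeartbeats 1000000

noncomputable section

variable {K : Type*} [Field K]

/-- A block upper bidiagonal matrix with constant diagonal block `A` and constant superdiagonal
block `-W` is right inverted by the block upper triangular Toeplitz matrix with blocks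
`S (W S)^(j-i)`, where `S` is a right inverse of `A`. -/
theorem bidiagonal_mul_toeplitz {R : Type*} [Ring R] (k : ℕ) {A S : R} (W : R) (h : A * S = 1) :
    ((Matrix.of fun i j : Fin k =>
        (if i = j then A else 0) - (if (i : ℕ) + 1 = (j : ℕ) then W else 0)) *
      (Matrix.of fun i j : Fin k =>
        if (i : ℕ) ≤ (j : ℕ) then S * (W * S) ^ ((j : ℕ) - (i : ℕ)) else 0)) = 1 := by
  ext i j
  simp only [Matrix.mul_apply, Matrix.of_apply, sub_mul, Finset.sum_sub_distrib, ite_mul, zero_mul,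
    Finset.sum_ite_eq, Finset.mem_univ, if_true, Matrix.one_apply]
  have hdiag : ∀ m : ℕ, A * (S * (W * S) ^ m) = (W * S) ^ m := fun m => by
    rw [← mul_assoc, h, one_mul]
  rcases lt_trichotomy (i : ℕ) (j : ℕ) with hij | hij | hij
  · have hne : i ≠ j := fun e => by simp [e] at hij
    rw [Finset.sum_eq_single (⟨(i : ℕ) + 1, by omega⟩ : Fin k)]
    · obtain ⟨m, hm⟩ : ∃ m, (j : ℕ) - (i : ℕ) = m + 1 := ⟨(j : ℕ) - (i : ℕ) - 1, by omega⟩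
      have hm' : (j : ℕ) - ((i : ℕ) + 1) = m := by omega
      rw [if_pos hij.le, if_pos rfl, if_pos (by simpa using hij), if_neg hne, hm, hdiag]
      simp only [hm', pow_succ', mul_assoc, sub_self]
    · intro l _ hl
      rw [if_neg fun e => hl (Fin.ext e.symm)]
    · simp
  · obtain rfl := Fin.ext hij
    rw [Finset.sum_eq_zero]
    · simp [h]
    · intro l _
      split_ifs <;> first | omega | simp
  · have hne : i ≠ j := fun e => by simp [e] at hij
    rw [Finset.sum_eq_zero]
    · simp [hne, hij.not_ge]
    · intro l _
      split_ifs <;> first | omega | simp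

theorem sISub_jacobson (n : ℕ) (p : K[X]) (k : ℕ) :
    sISub (jacobson n p k) = Matrix.compRingEquiv (Fin k) (Fin n) (RatFunc K)
      (Matrix.of fun i j => (if i = j then sISub (companion n p) else 0) -
        (if (i : ℕ) + 1 = (j : ℕ) then (eV K n).map (algebraMap K (RatFunc K)) else 0)) := by
  ext ⟨i, a⟩ ⟨j, b⟩
  simp only [sISub, jacobson, supN, Matrix.compRingEquiv_apply, Matrix.comp_apply, Matrix.of_apply,
    Matrix.sub_apply, Matrix.map_apply, Matrix.add_apply, Matrix.kroneckerMap_apply,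
    Matrix.diagonal_apply, Matrix.one_apply, Prod.mk.injEq, map_add, map_mul]
  by_cases hij : i = j <;> by_cases hs : (i : ℕ) + 1 = (j : ℕ) <;> 
    simp [hij, hs, Matrix.diagonal_apply]

/-- `sI - J(p^k)` is invertible over `K(s)`, and its inverse,
viewed as a `k × k` array of `n × n` blocks, has `(i,j)` block
`(sI - C)⁻¹ Q^{j-i}` for `i ≤ j` (where `Q = V (sI - C)⁻¹`) and `0` for `i > j`. -/
theorem jacobson_resolvent_blocks (n : ℕ) (hn : 1 ≤ n) (p : Polynomial K)
    (hp : p.Monic) (hdeg : p.natDegree = n) (k : ℕ) (hk : 1 ≤ k) :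
    IsUnit (sISub (jacobson n p k)) ∧
    ∀ (i j : Fin k) (a b : Fin n),
      (sISub (jacobson n p k))⁻¹ (i, a) (j, b) =
        if (i : ℕ) ≤ (j : ℕ) then
          ((sISub (companion n p))⁻¹ *
            ((eV K n).map (algebraMap K (RatFunc K)) *
              (sISub (companion n p))⁻¹) ^ ((j : ℕ) - (i : ℕ))) a b
        else 0 := by
  have hmul := congrArg (Matrix.compRingEquiv (Fin k) (Fin n) (RatFunc K))
    (bidiagonal_mul_toeplitz k ((eV K n).map (algebraMap K (RatFunc K)))
      (Matrix.mul_nonsing_inv _ (isUnit_det_sISub (companion n p))))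
  rw [map_mul, map_one, ← sISub_jacobson] at hmul
  refine ⟨(Matrix.isUnit_iff_isUnit_det _).2 (isUnit_det_sISub _), fun i j a b => ?_⟩
  rw [Matrix.inv_eq_right_inv hmul]
  simp only [Matrix.compRingEquiv_apply, Matrix.comp_apply, Matrix.of_apply]
  split_ifs <;> rfl

end
end

section
/- Let K be a field, p ∈ K[s] a monic irreducible polynomial of degree n, k ≥ 1, and A ∈ K^{nk×nk} a matrix whose characteristic polynomial and minimal polynomial both equal p^k (i.e. p^k is the only elementary divisor of A). Then A is similar over K to the Jacobson block J(p^k): there exists an invertible matrix S ∈ K^{nk×nk} with A = S · J(p^k) · S^{−1}. -/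
open Polynomial Matrix Kronecker

set_option synthInstance.maxHeartbeats 1000000
set_option maxHeartbeats 1000000

noncomputable section

variable {K : Type*} [Field K]

/-- If a power `p ^ k` of an irreducible polynomial lies in an ideal `I` but `p ^ (k - 1)` does not,
then `p`-adic expansions of length `k` are unique modulo `I`. -/
theorem eq_zero_of_sum_mul_pow_mem {p : K[X]} (hirr : Irreducible p) {k : ℕ} (I : Ideal K[X])
    (hk : p ^ k ∈ I) (hk' : p ^ (k - 1) ∉ I) (g : Fin k → K[X])
    (hg : ∀ a, (g a).degree < p.degree) (hsum : ∑ a, g a * p ^ (a : ℕ) ∈ I) (a : Fin k) :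
    g a = 0 := by
  induction a using WellFoundedLT.induction with
  | ind m ih =>
    by_contra hm
    have hcop : IsCoprime (g m) p := by
      refine ((hirr.coprime_iff_not_dvd).2 fun h => ?_).symm
      exact (hg m).not_ge (degree_le_of_dvd h hm)
    have hmul : g m * p ^ (k - 1) ∈ I := by
      have hmem := I.mul_mem_left (p ^ (k - 1 - (m : ℕ))) hsum
      rw [Finset.mul_sum, ← Finset.add_sum_erase _ _ (Finset.mem_univ m)] at hmem
      have hrest : ∑ a ∈ Finset.univ.erase m,
          p ^ (k - 1 - (m : ℕ)) * (g a * p ^ (a : ℕ)) ∈ I := by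
        refine I.sum_mem fun a ha => ?_
        rcases lt_or_gt_of_ne (Finset.ne_of_mem_erase ha) with h | h
        · simp [ih a h]
        · have hle : k ≤ k - 1 - (m : ℕ) + a := by omega
          rw [mul_left_comm, ← pow_add]
          exact I.mul_mem_left _ (I.mem_of_dvd (pow_dvd_pow p hle) hk)
      have hadd := (I.add_mem_iff_left hrest).1 hmem
      rwa [mul_left_comm, ← pow_add, Nat.sub_add_cancel (Nat.le_sub_one_of_lt m.isLt)] at hadd
    obtain ⟨x, y, hxy⟩ := hcop
    apply hk'
    have hpow : p ^ (k - 1) = x * (g m * p ^ (k - 1)) + y * p ^ k := by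
      have hsucc : p ^ k = p * p ^ (k - 1) := by
        rw [← pow_succ', Nat.sub_add_cancel m.pos]
      rw [hsucc]
      linear_combination -p ^ (k - 1) * hxy
    rw [hpow]
    exact I.add_mem (I.mul_mem_left _ hmul) (I.mul_mem_left _ hk)

theorem sum_companion_smul_X_pow {n : ℕ} {p : K[X]} (hp : p.Monic) (hdeg : p.natDegree = n)
    (i : Fin n) :
    ∑ j, companion n p i j • (X : K[X]) ^ (j : ℕ) =
      if (i : ℕ) = n - 1 then X ^ n - p else X ^ ((i : ℕ) + 1) := by
  split_ifs with hi
  · have hsum : p = ∑ j : Fin n, p.coeff j • (X : K[X]) ^ (j : ℕ) + X ^ n := by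
      conv_lhs => rw [hp.as_sum, hdeg, add_comm, Finset.sum_range]
      simp only [smul_eq_C_mul]
    have hrow : ∀ j : Fin n, companion n p i j = -p.coeff j := fun j => by
      have : (i : ℕ) + 1 ≠ j := by omega
      rw [companion, Matrix.of_apply, if_neg this, if_pos hi]
    simp only [hrow, neg_smul, Finset.sum_neg_distrib]
    linear_combination hsum
  · have hlt : (i : ℕ) + 1 < n := by omega
    rw [Finset.sum_eq_single ⟨i + 1, hlt⟩]
    · simp [companion]
    · intro j _ hj
      have : (i : ℕ) + 1 ≠ j := fun h => hj (Fin.ext h.symm)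
      simp [companion, this, hi]
    · simp

theorem sum_eV_smul_X_pow {n : ℕ} (i : Fin n) :
    ∑ j, eV K n i j • (X : K[X]) ^ (j : ℕ) = if (i : ℕ) = n - 1 then 1 else 0 := by
  rw [Finset.sum_eq_single ⟨0, i.pos⟩]
  · simp [eV]
  · intro j _ hj
    have : (j : ℕ) ≠ 0 := fun h => hj (Fin.ext h)
    simp [eV, this]
  · simp

theorem sum_supN_smul_pow {k : ℕ} (p : K[X]) (a : Fin k) :
    ∑ b, supN K k a b • p ^ (b : ℕ) = if (a : ℕ) + 1 < k then p ^ ((a : ℕ) + 1) else 0 := by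
  split_ifs with ha
  · rw [Finset.sum_eq_single ⟨a + 1, ha⟩]
    · simp [supN]
    · intro b _ hb
      have : (a : ℕ) + 1 ≠ b := fun h => hb (Fin.ext h.symm)
      simp [supN, this]
    · simp
  · refine Finset.sum_eq_zero fun b _ => ?_
    have : (a : ℕ) + 1 ≠ b := by omega
    simp [supN, this]

/-- The rows of the Jacobson block describe multiplication by `X` on the polynomials
`p ^ a * X ^ i`, modulo `p ^ k`. -/
theorem pow_dvd_X_mul_sub_sum_jacobson_smul {n : ℕ} {p : K[X]} (hp : p.Monic)
    (hdeg : p.natDegree = n) {k : ℕ} (r : Fin k × Fin n) :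
    p ^ k ∣ p ^ (r.1 : ℕ) * X ^ (r.2 : ℕ) * X -
      ∑ s : Fin k × Fin n, jacobson n p k r s • (p ^ (s.1 : ℕ) * X ^ (s.2 : ℕ)) := by
  obtain ⟨a, i⟩ := r
  have hsum : ∑ s : Fin k × Fin n, jacobson n p k (a, i) s • (p ^ (s.1 : ℕ) * X ^ (s.2 : ℕ)) =
      p ^ (a : ℕ) * (∑ j, companion n p i j • (X : K[X]) ^ (j : ℕ)) +
      (∑ b, supN K k a b • p ^ (b : ℕ)) * ∑ j, eV K n i j • (X : K[X]) ^ (j : ℕ) := by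
    have hone : p ^ (a : ℕ) = ∑ b, (1 : Matrix (Fin k) (Fin k) K) a b • p ^ (b : ℕ) := by
      simp [Matrix.one_apply]
    rw [hone, Finset.sum_mul_sum, Finset.sum_mul_sum, ← Finset.sum_add_distrib,
      Fintype.sum_prod_type]
    refine Finset.sum_congr rfl fun b _ => ?_
    rw [← Finset.sum_add_distrib]
    refine Finset.sum_congr rfl fun j _ => ?_
    rw [jacobson, Matrix.add_apply, Matrix.kroneckerMap_apply, Matrix.kroneckerMap_apply,
      smul_mul_smul_comm, smul_mul_smul_comm, add_smul]
  rw [hsum, sum_companion_smul_X_pow hp hdeg, sum_supN_smul_pow, sum_eV_smul_X_pow]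
  dsimp only
  by_cases hi : (i : ℕ) = n - 1
  · have hin : (X : K[X]) ^ n = X ^ (i : ℕ) * X := by
      rw [← pow_succ]; congr 1; omega
    rw [if_pos hi, if_pos hi, hin]
    split_ifs with ha
    · convert dvd_zero _ using 1
      ring
    · have hak : (a : ℕ) + 1 = k := by omega
      have hpk : p ^ k = p ^ (a : ℕ) * p := by rw [← pow_succ, hak]
      exact ⟨1, by rw [hpk]; ring⟩
  · rw [if_neg hi, if_neg hi]
    convert dvd_zero _ using 1
    ring

/-- The ideal of polynomials `f` such that `f(A)` kills the row vector `u`. -/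
def rowAnnihilator {ι : Type*} [Fintype ι] [DecidableEq ι] (A : Matrix ι ι K) (u : ι → K) :
    Ideal K[X] where
  carrier := {f | u ᵥ* aeval A f = 0}
  add_mem' {f g} hf hg := by
    simp only [Set.mem_ofPred_eq] at *
    rw [map_add, Matrix.vecMul_add, hf, hg, add_zero]
  zero_mem' := by simp
  smul_mem' c f hf := by
    simp only [Set.mem_ofPred_eq, smul_eq_mul] at *
    rw [mul_comm, map_mul, ← Matrix.vecMul_vecMul, hf, Matrix.zero_vecMul]

theorem mem_rowAnnihilator {ι : Type*} [Fintype ι] [DecidableEq ι] {A : Matrix ι ι K}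
    {u : ι → K} {f : K[X]} : f ∈ rowAnnihilator A u ↔ u ᵥ* aeval A f = 0 :=
  Iff.rfl

theorem exists_notMem_rowAnnihilator {ι : Type*} [Fintype ι] [DecidableEq ι]
    {A : Matrix ι ι K} {f : K[X]} (hf : aeval A f ≠ 0) : ∃ u, f ∉ rowAnnihilator A u := by
  contrapose! hf
  ext i j
  have := congrFun (mem_rowAnnihilator.1 (hf (Pi.single i 1))) j
  simpa using this

/-- a matrix whose characteristic and minimal polynomial both equal
`p^k` (i.e. whose only elementary divisor is `p^k`) is similar over `K`
to the Jacobson block `J(p^k)`. -/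
theorem similar_jacobson_of_charpoly_eq_minpoly (n : ℕ) (hn : 1 ≤ n)
    (p : Polynomial K) (hp : p.Monic) (hirr : Irreducible p) (hdeg : p.natDegree = n)
    (k : ℕ) (hk : 1 ≤ k) (A : Matrix (Fin k × Fin n) (Fin k × Fin n) K)
    (hchar : A.charpoly = p ^ k) (hmin : minpoly K A = p ^ k) :
    ∃ S : Matrix (Fin k × Fin n) (Fin k × Fin n) K,
      IsUnit S.det ∧ A = S * jacobson n p k * S⁻¹ := by
  have haev : aeval A (p ^ (k - 1)) ≠ 0 := fun h => by
    have hdvd : p ^ k ∣ p ^ (k - 1) := hmin ▸ minpoly.dvd K A h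
    have := (pow_dvd_pow_iff hirr.ne_zero hirr.not_isUnit).1 hdvd
    omega
  obtain ⟨u, hu⟩ := exists_notMem_rowAnnihilator haev
  have hpk : p ^ k ∈ rowAnnihilator A u := by
    rw [mem_rowAnnihilator, ← hmin, minpoly.aeval, Matrix.vecMul_zero]
  let φ : K[X] →ₗ[K] (Fin k × Fin n → K) :=
    Matrix.vecMulBilin K K u ∘ₗ (aeval A).toLinearMap
  have hφ : ∀ f, φ f = u ᵥ* aeval A f := fun f => rfl
  let Q : Fin k × Fin n → K[X] := fun s => p ^ (s.1 : ℕ) * X ^ (s.2 : ℕ)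
  let T : Matrix (Fin k × Fin n) (Fin k × Fin n) K := Matrix.of fun s => φ (Q s)
  have hTA : T * A = jacobson n p k * T := by
    ext r c
    have hmem := (rowAnnihilator A u).mem_of_dvd
      (pow_dvd_X_mul_sub_sum_jacobson_smul hp hdeg r) hpk
    rw [mem_rowAnnihilator, ← hφ, map_sub, sub_eq_zero, map_sum] at hmem
    have hrow := congrFun hmem c
    rw [hφ, map_mul, aeval_X, ← Matrix.vecMul_vecMul, ← hφ] at hrow
    simpa [Matrix.mul_apply, Matrix.vecMul, dotProduct, T, Q, Finset.sum_apply] using hrow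
  have hT : IsUnit T := by
    rw [← Matrix.linearIndependent_rows_iff_isUnit, Fintype.linearIndependent_iff]
    intro c hc
    let g : Fin k → K[X] := fun a => ∑ i : Fin n, c (a, i) • X ^ (i : ℕ)
    have hg : ∀ a, (g a).degree < p.degree := fun a => by
      rw [degree_eq_natDegree hp.ne_zero, hdeg]
      simp only [g, smul_eq_C_mul]
      exact degree_sum_fin_lt fun i => c (a, i)
    have hsum : ∑ a, g a * p ^ (a : ℕ) ∈ rowAnnihilator A u := by
      have : ∑ a, g a * p ^ (a : ℕ) = ∑ s, c s • Q s := by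
        rw [Fintype.sum_prod_type]
        refine Finset.sum_congr rfl fun a _ => ?_
        rw [Finset.sum_mul]
        refine Finset.sum_congr rfl fun i _ => ?_
        rw [smul_mul_assoc, mul_comm]
      rw [this, mem_rowAnnihilator, ← hφ, map_sum]
      simp only [map_smul]
      exact hc
    rintro ⟨a, i⟩
    have := congrArg (coeff · (i : ℕ))
      (eq_zero_of_sum_mul_pow_mem hirr (rowAnnihilator A u) hpk hu g hg hsum a)
    simpa [g, finsetSum_coeff, coeff_X_pow, Fin.val_inj] using this
  have hdet : IsUnit T.det := (Matrix.isUnit_iff_isUnit_det T).1 hT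
  refine ⟨T⁻¹, Matrix.isUnit_nonsing_inv_det T hdet, ?_⟩
  rw [Matrix.nonsing_inv_nonsing_inv T hdet, Matrix.mul_assoc, ← hTA,
    Matrix.nonsing_inv_mul_cancel_left _ _ hdet]

end
end

section
/- Let K be a field, λ ∈ K, k ≥ 1, and let h ∈ K[s]^q and g ∈ K[s]^t have expansions h = Σ_{i≥0} h_i (s−λ)^i and g = Σ_{i≥0} g_i (s−λ)^i with constant vectors h_i ∈ K^q, g_i ∈ K^t. Then π₋( h · (s−λ)^{−k} · gᵀ ) = (h_0, …, h_{k−1}) · ( (s−λ) I_k − N_k )^{−1} · (g_{k−1}ᵀ; …; g_0ᵀ), where (h_0, …, h_{k−1}) ∈ K^{q×k} and (g_{k−1}ᵀ; …; g_0ᵀ) ∈ K^{k×t} is the vertical stack of the rows g_{k−1}ᵀ, …, g_0ᵀ. -/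
open Polynomial Matrix Kronecker

set_option synthInstance.maxHeartbeats 1000000
set_option maxHeartbeats 1000000

noncomputable section

variable {K : Type*} [Field K]

/-- `piMinus` is the projection onto the strictly proper summand `a / m`. -/
theorem piMinus_eq_of_decomposition {a m y : Polynomial K} {f : RatFunc K} (hm : m ≠ 0)
    (ha : a.degree < m.degree)
    (hf : f = algebraMap (Polynomial K) (RatFunc K) a / algebraMap (Polynomial K) (RatFunc K) m +
      algebraMap (Polynomial K) (RatFunc K) y) :
    piMinus f = algebraMap (Polynomial K) (RatFunc K) a /
      algebraMap (Polynomial K) (RatFunc K) m := by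
  have hd : f.denom ≠ 0 := f.denom_ne_zero
  have hm' : algebraMap (Polynomial K) (RatFunc K) m ≠ 0 := RatFunc.algebraMap_ne_zero hm
  have hd' : algebraMap (Polynomial K) (RatFunc K) f.denom ≠ 0 := RatFunc.algebraMap_ne_zero hd
  have hcross : f.num * m = (a + y * m) * f.denom := by
    apply RatFunc.algebraMap_injective K
    have h1 := RatFunc.num_div_denom f
    conv_rhs at h1 => rw [hf]
    rw [div_add' _ _ _ hm', div_eq_div_iff hd' hm'] at h1
    simpa only [map_mul, map_add] using h1
  have hdiv := Polynomial.modByMonic_add_div f.num f.denom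
  have hr := Polynomial.degree_modByMonic_lt f.num f.monic_denom
  set quo := f.num /ₘ f.denom with hquo
  set r := f.num %ₘ f.denom
  have key : (y - quo) * (m * f.denom) = r * m - a * f.denom := by
    rw [← hdiv] at hcross
    linear_combination -hcross
  have hlt : (r * m - a * f.denom).degree < (m * f.denom).degree := by
    refine (Polynomial.degree_sub_le _ _).trans_lt (max_lt ?_ ?_)
    · rw [mul_comm m, Polynomial.degree_mul, Polynomial.degree_mul]
      exact WithBot.add_lt_add_right (Polynomial.degree_ne_bot.2 hm) hr
    · rw [Polynomial.degree_mul, Polynomial.degree_mul]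
      exact WithBot.add_lt_add_right (Polynomial.degree_ne_bot.2 hd) ha
  have hyq : y - quo = 0 := by
    have hzero := Polynomial.eq_zero_of_dvd_of_degree_lt ⟨_, key.symm.trans (mul_comm _ _)⟩ hlt
    exact (mul_eq_zero.1 (key.trans hzero)).resolve_right (mul_ne_zero hm hd)
  rw [piMinus, ← hquo, ← sub_eq_zero.mp hyq]
  exact sub_eq_of_eq_add hf

/-- The resolvent of the nilpotent Jordan block is upper triangular Toeplitz. -/
theorem inv_smul_one_sub_supN {F : Type*} [Field F] {x : F} (hx : x ≠ 0) (k : ℕ) :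
    (x • (1 : Matrix (Fin k) (Fin k) F) - supN F k)⁻¹ =
      Matrix.of fun i j : Fin k =>
        if (i : ℕ) ≤ j then (x ^ ((j : ℕ) - i + 1))⁻¹ else 0 := by
  apply Matrix.inv_eq_right_inv
  ext i j
  rw [Matrix.sub_mul, Matrix.smul_mul, Matrix.one_mul, Matrix.sub_apply, Matrix.smul_apply,
    Matrix.mul_apply, Matrix.one_apply]
  simp only [supN, Matrix.of_apply, ite_mul, one_mul, zero_mul, smul_eq_mul]
  rcases lt_trichotomy (i : ℕ) j with hij | hij | hij
  · have hik : (i : ℕ) + 1 < k := by omega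
    rw [Finset.sum_eq_single (⟨i + 1, hik⟩ : Fin k)]
    · have hne : i ≠ j := fun e => by simp [e] at hij
      have he : (j : ℕ) - i = (j - (i + 1)) + 1 := by omega
      rw [if_pos hij.le, if_pos rfl, if_pos (Nat.succ_le_of_lt hij), if_neg hne, he]
      field_simp
      ring
    · intro l _ hl
      rw [if_neg]
      exact fun e => hl (Fin.ext e.symm)
    · simp
  · rw [Finset.sum_eq_zero, if_pos hij.le, if_pos (Fin.ext hij), hij]
    · simp [hx]
    · intro l _
      split_ifs <;> first | rfl | omega
  · have hne : i ≠ j := fun e => by simp [e] at hij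
    rw [Finset.sum_eq_zero, if_neg hij.not_ge, if_neg hne]
    · simp
    · intro l _
      split_ifs <;> first | rfl | omega

/-- A product of two expansions in powers of `x`, split off modulo `x ^ k`. -/
theorem sum_mul_sum_eq_truncation_add {R : Type*} [CommRing R] (x : R) (u v : ℕ → R) {k D : ℕ}
    (hkD : k ≤ D) :
    ∃ y, (∑ i ∈ Finset.range D, u i * x ^ i) * (∑ j ∈ Finset.range D, v j * x ^ j) =
      (∑ i ∈ Finset.range k, ∑ j ∈ Finset.range k,
        if i + j < k then u i * v j * x ^ (i + j) else 0) + y * x ^ k := by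
  refine ⟨∑ i ∈ Finset.range D, ∑ j ∈ Finset.range D,
    if i + j < k then 0 else u i * v j * x ^ (i + j - k), ?_⟩
  have htrunc : (∑ i ∈ Finset.range k, ∑ j ∈ Finset.range k,
      if i + j < k then u i * v j * x ^ (i + j) else 0) =
      ∑ i ∈ Finset.range D, ∑ j ∈ Finset.range D,
        if i + j < k then u i * v j * x ^ (i + j) else 0 := by
    have hsub : Finset.range k ⊆ Finset.range D := Finset.range_subset_range.2 hkD
    rw [← Finset.sum_subset hsub]
    · refine Finset.sum_congr rfl fun i _ => Finset.sum_subset hsub fun j _ hj => if_neg ?_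
      rw [Finset.mem_range] at hj
      omega
    · refine fun i _ hi => Finset.sum_eq_zero fun j _ => if_neg ?_
      rw [Finset.mem_range] at hi
      omega
  rw [htrunc, Finset.sum_mul_sum, Finset.sum_mul, ← Finset.sum_add_distrib]
  refine Finset.sum_congr rfl fun i _ => ?_
  rw [Finset.sum_mul, ← Finset.sum_add_distrib]
  refine Finset.sum_congr rfl fun j _ => ?_
  split_ifs with hij
  · ring
  · rw [zero_add, mul_assoc _ _ (x ^ k), ← pow_add, Nat.sub_add_cancel (not_lt.mp hij)]
    ring

/-- Kalman's special case `p = s - λ`: with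
`h = Σ hᵢ (s-λ)ⁱ`, `g = Σ gᵢ (s-λ)ⁱ` (constant coefficient vectors),
`π₋( h (s-λ)^{-k} gᵀ ) = (h₀, …, h_{k-1}) ((s-λ)Iₖ - Nₖ)⁻¹ (g_{k-1}ᵀ; …; g₀ᵀ)`. -/
theorem piMinus_realization_jordan (lam : K) (k : ℕ) (hk : 1 ≤ k) (q t : ℕ)
    (h : Fin q → Polynomial K) (g : Fin t → Polynomial K)
    (hcoef : ℕ → Fin q → K) (gcoef : ℕ → Fin t → K)
    (D : ℕ) (hDk : k ≤ D)
    (hexp : ∀ a, h a = ∑ i ∈ Finset.range D,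
      Polynomial.C (hcoef i a) * (Polynomial.X - Polynomial.C lam) ^ i)
    (gexp : ∀ b, g b = ∑ i ∈ Finset.range D,
      Polynomial.C (gcoef i b) * (Polynomial.X - Polynomial.C lam) ^ i) :
    (Matrix.of fun (a : Fin q) (b : Fin t) =>
        piMinus (algebraMap (Polynomial K) (RatFunc K) (h a) *
          (((RatFunc.X : RatFunc K) - algebraMap K (RatFunc K) lam) ^ k)⁻¹ *
          algebraMap (Polynomial K) (RatFunc K) (g b))) =
      (Matrix.of fun (a : Fin q) (i : Fin k) =>
          algebraMap K (RatFunc K) (hcoef (i : ℕ) a)) *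
        (((RatFunc.X : RatFunc K) - algebraMap K (RatFunc K) lam) •
            (1 : Matrix (Fin k) (Fin k) (RatFunc K)) - supN (RatFunc K) k)⁻¹ *
      (Matrix.of fun (i : Fin k) (b : Fin t) =>
          algebraMap K (RatFunc K) (gcoef (k - 1 - (i : ℕ)) b)) := by
  set x : RatFunc K := RatFunc.X - algebraMap K (RatFunc K) lam with hx
  have hxmap : algebraMap (Polynomial K) (RatFunc K) (Polynomial.X - Polynomial.C lam) = x := by
    rw [map_sub, RatFunc.algebraMap_X, RatFunc.algebraMap_C, hx, RatFunc.algebraMap_eq_C]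
  have hx0 : x ≠ 0 := by
    rw [← hxmap]
    exact RatFunc.algebraMap_ne_zero (Polynomial.X_sub_C_ne_zero lam)
  have hmonic : ((Polynomial.X - Polynomial.C lam) ^ k).Monic :=
    (Polynomial.monic_X_sub_C lam).pow k
  ext a b
  obtain ⟨y, hy⟩ := sum_mul_sum_eq_truncation_add (Polynomial.X - Polynomial.C lam)
    (fun i => Polynomial.C (hcoef i a)) (fun j => Polynomial.C (gcoef j b)) hDk
  rw [← hexp, ← gexp] at hy
  rw [Matrix.of_apply, piMinus_eq_of_decomposition (y := y) hmonic.ne_zero ?_ ?_,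
    inv_smul_one_sub_supN hx0, Matrix.mul_apply]
  rotate_left
  · exact ∑ i ∈ Finset.range k, ∑ j ∈ Finset.range k,
      if i + j < k then Polynomial.C (hcoef i a) * Polynomial.C (gcoef j b) *
        (Polynomial.X - Polynomial.C lam) ^ (i + j) else 0
  · rw [Polynomial.degree_pow, Polynomial.degree_X_sub_C, nsmul_one, ← Polynomial.mem_degreeLT]
    refine Submodule.sum_mem _ fun i _ => Submodule.sum_mem _ fun j _ => ?_
    split_ifs with hij
    · rw [Polynomial.mem_degreeLT, ← Polynomial.C_mul]
      rw [← Polynomial.smul_eq_C_mul]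
      refine (Polynomial.degree_smul_le _ _).trans_lt ?_
      rw [Polynomial.degree_pow, Polynomial.degree_X_sub_C, nsmul_one]
      exact_mod_cast hij
    · exact Submodule.zero_mem _
  · rw [mul_right_comm, ← map_mul, hy, map_add, map_mul, map_pow, hxmap, add_mul,
      mul_inv_cancel_right₀ (pow_ne_zero k hx0), div_eq_mul_inv]
  rw [map_pow, hxmap, Finset.sum_comm, map_sum, Finset.sum_div,
    ← Finset.sum_range_reflect, Finset.sum_range]
  refine Finset.sum_congr rfl fun j _ => ?_
  rw [Matrix.mul_apply, Finset.sum_mul, map_sum, Finset.sum_div, Finset.sum_range]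
  refine Finset.sum_congr rfl fun i _ => ?_
  simp only [Matrix.of_apply]
  have hj := j.isLt
  by_cases hij : (i : ℕ) ≤ j
  · rw [if_pos hij, if_pos (by omega), map_mul, map_mul, map_pow, hxmap, RatFunc.algebraMap_C,
      RatFunc.algebraMap_C, ← RatFunc.algebraMap_eq_C]
    have hk' : k = (i + (k - 1 - j)) + (j - i + 1) := by omega
    have hpow : x ^ k = x ^ ((i : ℕ) + (k - 1 - j)) * x ^ ((j : ℕ) - i + 1) := by
      rw [← pow_add, ← hk']
    rw [hpow]
    field_simp
  · rw [if_neg hij, if_neg (by omega)]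
    simp

end
end
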